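/- For the degree 6 part of the symplectic derivation Lie algebra: dim_ℚ h_{1,1}(6)^{Sp} = 1, dim_ℚ h_{2,1}(6)^{Sp} = 4, and dim_ℚ h_{g,1}(6)^{Sp} = 5 for every g ≥ 3. -/

import Mathlib

noncomputable section

open Finset

/-! ## The symplectic vector space `H = ℚ^{2g}` and its tensor powers -/

/-- `H_g = ℚ^{2g}`, with symplectic basis `x_1, y_1, …, x_g, y_g`
(`x_i` at index `2(i-1)`, `y_i` at index `2(i-1)+1`). -/
abbrev HH (g : ℕ) := Fin (2*g) → ℚ

/-- The tensor power `H^{⊗m}`, modelled as coefficient functions on words in the basis. -/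
abbrev Tens (g m : ℕ) := (Fin m → Fin (2*g)) → ℚ

/-- index of `x_i` -/
def xI {g : ℕ} (i : Fin g) : Fin (2*g) := ⟨2*i.val, by have := i.isLt; omega⟩
/-- index of `y_i` -/
def yI {g : ℕ} (i : Fin g) : Fin (2*g) := ⟨2*i.val+1, by have := i.isLt; omega⟩

/-- standard basis vectors of `HH g` -/
def stdB (g : ℕ) (a : Fin (2*g)) : HH g := fun b => if b = a then 1 else 0

/-- the symplectic form `ω` on `HH g` -/
def omegaF {g : ℕ} (u v : HH g) : ℚ :=
  ∑ i : Fin g, (u (xI i) * v (yI i) - u (yI i) * v (xI i))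

/-- `ω(e_a , e_b)` on basis vectors -/
def omegaB (g : ℕ) (a b : Fin (2*g)) : ℚ := omegaF (stdB g a) (stdB g b)

/-- the pure tensor `u ⊗ ξ` -/
def oneTmul {g m : ℕ} (u : HH g) (ξ : Tens g m) : Tens g (m+1) :=
  fun w => u (w 0) * ξ (fun i => w i.succ)

/-- the bracket `[u, ξ] = u ⊗ ξ - ξ ⊗ u` in the tensor algebra -/
def oneBrkt {g m : ℕ} (u : HH g) (ξ : Tens g m) : Tens g (m+1) :=
  fun w => u (w 0) * ξ (fun i => w i.succ)
    - ξ (fun i => w i.castSucc) * u (w (Fin.last m))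

/-- left-normed Lie bracket `[u 0, [u 1, [… , u m]…]]` -/
def leftNormed (g : ℕ) : (m : ℕ) → (Fin (m+1) → HH g) → Tens g (m+1)
  | 0, u => fun w => u 0 (w 0)
  | (m+1), u => oneBrkt (u 0) (leftNormed g m (fun i => u i.succ))

/-- `L_{g,1}(m+1)`: the degree `m+1` part of the free Lie algebra on `HH g`,
i.e. the span of the left-normed brackets, inside `H^{⊗(m+1)}`. -/
def Lsub (g m : ℕ) : Submodule ℚ (Tens g (m+1)) :=
  Submodule.span ℚ (Set.range (leftNormed g m))

/-- the linear extension of `u ⊗ ξ ↦ u ⊗ ξ - ξ ⊗ u` to all of `H^{⊗(m+1)}` -/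
def betaFun {g m : ℕ} (t : Tens g (m+1)) : Tens g (m+1) :=
  fun w => t w - t (fun i => Fin.cases (w (Fin.last m)) (fun j => w j.castSucc) i)

/-- `betaFun` as a linear map -/
def betaL (g m : ℕ) : Tens g (m+1) →ₗ[ℚ] Tens g (m+1) where
  toFun := betaFun
  map_add' a b := by funext w; simp only [betaFun, Pi.add_apply]; ring
  map_smul' c a := by
    funext w
    simp only [betaFun, Pi.smul_apply, smul_eq_mul, RingHom.id_apply]
    ring

/-- `H ⊗ L_{g,1}(k+1)` inside `H^{⊗(k+2)}` -/
def HLsub (g k : ℕ) : Submodule ℚ (Tens g (k+2)) :=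
  Submodule.span ℚ {t | ∃ (u : HH g) (ξ : Tens g (k+1)), ξ ∈ Lsub g k ∧ t = oneTmul u ξ}

/-- `h_{g,1}(k) = Ker ([·,·] : H ⊗ L_{g,1}(k+1) → L_{g,1}(k+2))`,
as a subspace of `H^{⊗(k+2)}`. -/
def hgl (g k : ℕ) : Submodule ℚ (Tens g (k+2)) :=
  HLsub g k ⊓ LinearMap.ker (betaL g (k+1))

/-- the symplectic group `Sp(2g,ℚ)`: linear automorphisms preserving `ω` -/
def SpSet (g : ℕ) : Set (HH g ≃ₗ[ℚ] HH g) :=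
  {f | ∀ u v : HH g, omegaF (f u) (f v) = omegaF u v}

/-- the diagonal action of a map `f : H → H` on `H^{⊗m}` -/
def tensMapF {g m : ℕ} (f : HH g → HH g) (t : Tens g m) : Tens g m :=
  fun w' => ∑ w : Fin m → Fin (2*g), t w * ∏ i, f (stdB g (w i)) (w' i)

/-- the subspace of `Sp(2g,ℚ)`-invariant tensors in `H^{⊗m}` -/
def spInv (g m : ℕ) : Submodule ℚ (Tens g m) where
  carrier := {t | ∀ f : HH g ≃ₗ[ℚ] HH g, f ∈ SpSet g → tensMapF (⇑f) t = t}
  add_mem' := by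
    intro a b ha hb f hf
    have h : tensMapF (⇑f) (a + b) = tensMapF (⇑f) a + tensMapF (⇑f) b := by
      funext w'
      simp only [tensMapF, Pi.add_apply, add_mul]
      rw [Finset.sum_add_distrib]
    rw [Set.mem_setOf_eq] at *
    rw [h, ha f hf, hb f hf]
  zero_mem' := by
    intro f hf
    funext w'
    simp [tensMapF]
  smul_mem' := by
    intro c a ha f hf
    have h : tensMapF (⇑f) (c • a) = c • tensMapF (⇑f) a := by
      funext w'
      simp only [tensMapF, Pi.smul_apply, smul_eq_mul, Finset.mul_sum]
      exact Finset.sum_congr rfl fun w _ => by ring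
    rw [h, ha f hf]

/-- the `Sp`-invariant part `h_{g,1}(k)^{Sp}` -/
def hSp (g k : ℕ) : Submodule ℚ (Tens g (k+2)) := hgl g k ⊓ spInv g (k+2)

/-- the symmetric bilinear form `μ^{⊗m}` on `H^{⊗m}` -/
def muF {g m : ℕ} (ξ η : Tens g m) : ℚ :=
  ∑ w : Fin m → Fin (2*g), ∑ w' : Fin m → Fin (2*g),
    ξ w * η w' * ∏ i, omegaB g (w i) (w' i)

/-! ## The symplectic form on basis vectors -/

section SymplecticForm
variable {g : ℕ}

theorem xI_ne_yI (i j : Fin g) : xI i ≠ yI j := by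
  simp only [xI, yI, ne_eq, Fin.mk.injEq]; omega

theorem xI_injective : Function.Injective (xI (g := g)) := fun i j h => by
  simp only [xI, Fin.mk.injEq] at h; ext; omega

theorem yI_injective : Function.Injective (yI (g := g)) := fun i j h => by
  simp only [yI, Fin.mk.injEq] at h; ext; omega

theorem exists_xI_or_yI (a : Fin (2 * g)) : ∃ i, a = xI i ∨ a = yI i := by
  refine ⟨⟨a.val / 2, by omega⟩, ?_⟩
  simp only [xI, yI, Fin.ext_iff]; omega

theorem sum_xI_yI (f : Fin (2 * g) → ℚ) : ∑ a, f a = ∑ i, (f (xI i) + f (yI i)) := by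
  rw [sum_add_distrib, ← Fintype.sum_sumElim]
  symm
  refine Fintype.sum_bijective (Sum.elim xI yI) ⟨?_, ?_⟩ _ _ (by rintro (i | i) <;> rfl)
  · exact xI_injective.sumElim yI_injective xI_ne_yI
  · intro a
    obtain ⟨i, rfl | rfl⟩ := exists_xI_or_yI a
    · exact ⟨Sum.inl i, rfl⟩
    · exact ⟨Sum.inr i, rfl⟩

theorem omegaB_swap (a b : Fin (2 * g)) : omegaB g b a = -omegaB g a b := by
  simp only [omegaB, omegaF, ← sum_neg_distrib]
  exact sum_congr rfl fun i _ => by ring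

theorem omegaB_xI_yI (i j : Fin g) : omegaB g (xI i) (yI j) = if i = j then 1 else 0 := by
  simp only [omegaB, omegaF, stdB, xI_injective.eq_iff, yI_injective.eq_iff, xI_ne_yI,
    (xI_ne_yI _ _).symm, if_false, mul_zero, sub_zero, mul_ite, mul_one, sum_ite_eq', mem_univ,
    if_true]
  simp [eq_comm]

theorem omegaB_yI_xI (i j : Fin g) : omegaB g (yI i) (xI j) = -if i = j then 1 else 0 := by
  rw [omegaB_swap, omegaB_xI_yI, if_congr eq_comm rfl rfl]

theorem omegaB_xI_xI (i j : Fin g) : omegaB g (xI i) (xI j) = 0 := by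
  simp [omegaB, omegaF, stdB, (xI_ne_yI _ _).symm]

theorem omegaB_yI_yI (i j : Fin g) : omegaB g (yI i) (yI j) = 0 := by
  simp [omegaB, omegaF, stdB, xI_ne_yI]

theorem sum_omegaB_mul_omegaB (a b : Fin (2 * g)) :
    ∑ c, omegaB g c a * omegaB g c b = if a = b then 1 else 0 := by
  rw [sum_xI_yI]
  obtain ⟨i, rfl | rfl⟩ := exists_xI_or_yI a <;> obtain ⟨j, rfl | rfl⟩ := exists_xI_or_yI b <;>
  simp [omegaB_xI_yI, omegaB_yI_xI, omegaB_xI_xI, omegaB_yI_yI, xI_injective.eq_iff,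
    yI_injective.eq_iff, xI_ne_yI, (xI_ne_yI _ _).symm, eq_comm]

theorem omegaF_eq_sum (u v : HH g) : omegaF u v = ∑ a, ∑ b, omegaB g a b * (u a * v b) := by
  simp only [sum_xI_yI, omegaB_xI_yI, omegaB_yI_xI, omegaB_xI_xI, omegaB_yI_yI, sum_add_distrib]
  simp [omegaF, sum_add_distrib, sub_eq_add_neg, add_comm]

theorem omegaF_add_right (u v w : HH g) : omegaF u (v + w) = omegaF u v + omegaF u w := by
  simp only [omegaF, ← sum_add_distrib, Pi.add_apply]
  exact sum_congr rfl fun i _ => by ring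

theorem omegaF_smul_right (c : ℚ) (u v : HH g) : omegaF u (c • v) = c * omegaF u v := by
  simp only [omegaF, mul_sum, Pi.smul_apply, smul_eq_mul]
  exact sum_congr rfl fun i _ => by ring

theorem omegaF_swap (u v : HH g) : omegaF v u = -omegaF u v := by
  simp only [omegaF, ← sum_neg_distrib]
  exact sum_congr rfl fun i _ => by ring

theorem omegaF_self (u : HH g) : omegaF u u = 0 := by
  simp [omegaF, mul_comm]

/-- The symplectic transvection `v ↦ v + s ω(u, v) u`. -/
def sympTransvection (u : HH g) (s : ℚ) : HH g ≃ₗ[ℚ] HH g where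
  toFun v := v + (s * omegaF u v) • u
  invFun v := v - (s * omegaF u v) • u
  map_add' v w := by rw [omegaF_add_right]; module
  map_smul' c v := by rw [omegaF_smul_right]; simp only [RingHom.id_apply]; module
  left_inv v := by
    simp only [omegaF_add_right, omegaF_smul_right, omegaF_self]; module
  right_inv v := by
    simp only [sub_eq_add_neg, ← neg_smul, omegaF_add_right, omegaF_smul_right, omegaF_self]; module

theorem sympTransvection_mem (u : HH g) (s : ℚ) : sympTransvection u s ∈ SpSet g := by
  intro v w
  change omegaF (v + (s * omegaF u v) • u) (w + (s * omegaF u w) • u) = _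
  rw [omegaF_add_right, omegaF_smul_right, omegaF_swap w, omegaF_swap u (v + _), omegaF_add_right,
    omegaF_add_right, omegaF_smul_right, omegaF_smul_right, omegaF_self, omegaF_swap v w,
    omegaF_swap u w]
  ring

/-- Symplectic matrices preserve the bivector dual to the form. -/
theorem sum_omegaB_apply (f : HH g ≃ₗ[ℚ] HH g) (hf : f ∈ SpSet g) (a b : Fin (2 * g)) :
    ∑ a', ∑ b', omegaB g a' b' * (f (stdB g a) a' * f (stdB g b) b') = omegaB g a b := by
  rw [← omegaF_eq_sum, hf, omegaB]

end SymplecticForm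

/-! ## Infinitesimal invariance -/

section Casimir
variable {g m : ℕ}

theorem sum_mul_prod_erase_stdB (G : (Fin m → Fin (2 * g)) → ℚ) (w : Fin m → Fin (2 * g))
    (i : Fin m) :
    ∑ v, G v * ∏ j ∈ univ.erase i, stdB g (v j) (w j) = ∑ a, G (Function.update w i a) := by
  have h : ∀ v : Fin m → Fin (2 * g), ∏ j ∈ univ.erase i, stdB g (v j) (w j) =
      if v = Function.update w i (v i) then 1 else 0 := by
    intro v
    split_ifs with hv
    · refine prod_eq_one fun j hj => ?_
      rw [hv, Function.update_of_ne (ne_of_mem_erase hj)]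
      simp [stdB]
    · simp only [Function.eq_update_iff, true_and, not_forall] at hv
      obtain ⟨j, hj, hne⟩ := hv
      exact prod_eq_zero (mem_erase.2 ⟨hj, mem_univ j⟩) (if_neg (Ne.symm hne))
  simp only [h, mul_ite, mul_one, mul_zero]
  rw [← sum_filter]
  refine sum_nbij' (fun v => v i) (fun a => Function.update w i a) ?_ ?_ ?_ ?_ ?_
  · simp
  · simp
  · intro v hv
    exact (mem_filter.1 hv).2.symm
  · simp
  · intro v hv
    rw [← (mem_filter.1 hv).2]

theorem sum_insert_quadratic_eq_zero {t : Tens g m} (ht : t ∈ spInv g m) (u : HH g)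
    (w : Fin m → Fin (2 * g)) :
    ∑ i, ∑ a, t (Function.update w i a) * (omegaF u (stdB g a) * u (w i)) = 0 := by
  let F : ℚ → ℚ := fun s =>
    ∑ v, t v * ∏ j, (stdB g (v j) (w j) + s * (omegaF u (stdB g (v j)) * u (w j)))
  have hF : ∀ s, F s = t w := by
    intro s
    have := congrFun (ht _ (sympTransvection_mem u s)) w
    rw [← this]
    refine sum_congr rfl fun v _ => ?_
    congr 1
    refine prod_congr rfl fun j _ => ?_
    change _ = (stdB g (v j) + (s * omegaF u (stdB g (v j))) • u) (w j)
    simp only [Pi.add_apply, Pi.smul_apply, smul_eq_mul]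
    ring
  have hd : HasDerivAt F (∑ v, t v * ∑ i, (∏ j ∈ univ.erase i, stdB g (v j) (w j)) *
      (omegaF u (stdB g (v i)) * u (w i))) 0 := by
    refine HasDerivAt.fun_sum fun v _ => HasDerivAt.const_mul _ ?_
    have := HasDerivAt.fun_finsetProd (u := univ) (x := (0 : ℚ))
      (f := fun j s => stdB g (v j) (w j) + s * (omegaF u (stdB g (v j)) * u (w j)))
      (f' := fun j => omegaF u (stdB g (v j)) * u (w j)) fun j _ => by
        simpa using ((hasDerivAt_id (0 : ℚ)).mul_const (omegaF u (stdB g (v j)) * u (w j))).const_add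
          (stdB g (v j) (w j))
    simpa using this
  have h0 := hd.unique ((hasDerivAt_const (0 : ℚ) (t w)).congr_of_eventuallyEq
    (Filter.Eventually.of_forall hF))
  rw [← h0]
  simp only [mul_sum]
  rw [sum_comm (s := univ (α := Fin m → Fin (2 * g)))]
  refine sum_congr rfl fun i _ => ?_
  have h := sum_mul_prod_erase_stdB (fun v => t v * (omegaF u (stdB g (v i)) * u (w i))) w i
  simp only [Function.update_self] at h
  rw [← h]
  exact sum_congr rfl fun v _ => by ring

theorem sum_insert_bilinear_eq_zero {t : Tens g m} (ht : t ∈ spInv g m) (c d : Fin (2 * g))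
    (w : Fin m → Fin (2 * g)) :
    ∑ i, ∑ a, t (Function.update w i a) * (omegaB g c a * stdB g d (w i)) +
      ∑ i, ∑ a, t (Function.update w i a) * (omegaB g d a * stdB g c (w i)) = 0 := by
  have hadd : ∀ (u v x : HH g), omegaF (u + v) x = omegaF u x + omegaF v x := fun u v x => by
    rw [omegaF_swap x, omegaF_add_right, omegaF_swap u x, omegaF_swap v x]; ring
  have h := sum_insert_quadratic_eq_zero ht (stdB g c + stdB g d) w
  simp only [hadd, Pi.add_apply, add_mul, mul_add, sum_add_distrib] at h
  have hc := sum_insert_quadratic_eq_zero ht (stdB g c) w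
  have hd := sum_insert_quadratic_eq_zero ht (stdB g d) w
  simp only [omegaB]
  linarith

/-- Contraction of the slots `p` and `i`, the remaining slots being filled by `w`. -/
def contractAt (t : Tens g m) (p i : Fin m) (w : Fin m → Fin (2 * g)) : ℚ :=
  ∑ a, ∑ b, omegaB g a b * t (Function.update (Function.update w p a) i b)

/-- The Casimir identity in the slot `p` of an invariant tensor. -/
theorem casimir_slot {t : Tens g m} (ht : t ∈ spInv g m) (p : Fin m) (w : Fin m → Fin (2 * g)) :
    (2 * g + 1) * t w + ∑ i ∈ univ.erase p, t (w ∘ Equiv.swap p i) =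
      ∑ i ∈ univ.erase p, omegaB g (w p) (w i) * contractAt t p i w := by
  have key : ∑ c, ∑ d, omegaB g c (w p) *
      (∑ i, ∑ a, t (Function.update (Function.update w p d) i a) *
          (omegaB g c a * stdB g d (Function.update w p d i)) +
        ∑ i, ∑ a, t (Function.update (Function.update w p d) i a) *
          (omegaB g d a * stdB g c (Function.update w p d i))) = 0 :=
    sum_eq_zero fun c _ => sum_eq_zero fun d _ => by
      rw [sum_insert_bilinear_eq_zero ht, mul_zero]
  simp only [mul_add, sum_add_distrib] at key
  have h1 : ∑ c, ∑ d, omegaB g c (w p) *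
      (∑ i, ∑ a, t (Function.update (Function.update w p d) i a) *
          (omegaB g c a * stdB g d (Function.update w p d i))) =
      2 * g * t w + ∑ i ∈ univ.erase p, t (w ∘ Equiv.swap p i) := by
    have e : ∀ d i, ∑ c, omegaB g c (w p) *
        (∑ a, t (Function.update (Function.update w p d) i a) *
          (omegaB g c a * stdB g d (Function.update w p d i))) =
        t (Function.update (Function.update w p d) i (w p)) *
          stdB g d (Function.update w p d i) := by
      intro d i
      simp only [mul_sum]
      rw [sum_comm]
      have : ∀ a, ∑ c, omegaB g c (w p) * (t (Function.update (Function.update w p d) i a) *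
          (omegaB g c a * stdB g d (Function.update w p d i))) =
          (if a = w p then 1 else 0) * (t (Function.update (Function.update w p d) i a) *
          stdB g d (Function.update w p d i)) := by
        intro a
        rw [← sum_omegaB_mul_omegaB, sum_mul]
        exact sum_congr rfl fun c _ => by ring
      simp [this]
    calc _ = ∑ d, ∑ i, t (Function.update (Function.update w p d) i (w p)) *
          stdB g d (Function.update w p d i) := by
          rw [sum_comm]
          refine sum_congr rfl fun d _ => ?_
          simp only [← e]
          rw [sum_comm]
          exact sum_congr rfl fun c _ => by rw [mul_sum]
      _ = _ := by
          rw [sum_comm, ← add_sum_erase _ _ (mem_univ p)]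
          congr 1
          · simp [stdB]
          · refine sum_congr rfl fun i hi => ?_
            have hip := ne_of_mem_erase hi
            simp only [Function.update_of_ne hip, stdB, mul_ite, mul_one, mul_zero, sum_ite_eq,
              mem_univ, if_true]
            congr 1
            rw [Equiv.swap_comm, Equiv.comp_swap_eq_update]
  have h2 : ∑ c, ∑ d, omegaB g c (w p) *
      (∑ i, ∑ a, t (Function.update (Function.update w p d) i a) *
          (omegaB g d a * stdB g c (Function.update w p d i))) =
      t w - ∑ i ∈ univ.erase p, omegaB g (w p) (w i) * contractAt t p i w := by
    have e : ∀ d i, ∑ c, omegaB g c (w p) *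
        (∑ a, t (Function.update (Function.update w p d) i a) *
          (omegaB g d a * stdB g c (Function.update w p d i))) =
        omegaB g (Function.update w p d i) (w p) *
          ∑ a, omegaB g d a * t (Function.update (Function.update w p d) i a) := by
      intro d i
      have : ∀ c, omegaB g c (w p) *
        (∑ a, t (Function.update (Function.update w p d) i a) *
          (omegaB g d a * stdB g c (Function.update w p d i))) =
          (if Function.update w p d i = c then 1 else 0) * (omegaB g c (w p) *
          ∑ a, omegaB g d a * t (Function.update (Function.update w p d) i a)) := by
        intro c
        simp only [mul_sum, stdB]
        exact sum_congr rfl fun c _ => by ring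
      simp [this]
    calc _ = ∑ d, ∑ i, omegaB g (Function.update w p d i) (w p) *
          ∑ a, omegaB g d a * t (Function.update (Function.update w p d) i a) := by
          rw [sum_comm]
          refine sum_congr rfl fun d _ => ?_
          simp only [← e]
          rw [sum_comm]
          exact sum_congr rfl fun c _ => by rw [mul_sum]
      _ = _ := by
          rw [sum_comm, ← add_sum_erase _ _ (mem_univ p), sub_eq_add_neg, ← sum_neg_distrib]
          congr 1
          · simp only [Function.update_self, Function.update_idem, mul_sum, ← mul_assoc]
            rw [sum_comm]
            simp only [← sum_mul, sum_omegaB_mul_omegaB]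
            simp
          · refine sum_congr rfl fun i hi => ?_
            have hip := ne_of_mem_erase hi
            simp only [Function.update_of_ne hip, contractAt]
            rw [omegaB_swap (w p), ← mul_sum, neg_mul]
  rw [h1, h2] at key
  linarith

end Casimir

/-! ## The first fundamental theorem -/

section FirstFundamentalTheorem
variable {g m : ℕ}

theorem comp_perm_mem_spInv {t : Tens g m} (ht : t ∈ spInv g m) (π : Equiv.Perm (Fin m)) :
    (fun w => t (w ∘ π)) ∈ spInv g m := by
  intro f hf
  funext w'
  have h := congrFun (ht f hf) (w' ∘ π)
  rw [← h]
  refine Fintype.sum_equiv (π.arrowCongr (Equiv.refl _)).symm _ _ fun w => ?_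
  congr 1
  exact (Equiv.prod_comp π fun i => f (stdB g (w i)) (w' i)).symm

/-- A submodule containing all partial Casimir images of invariants contains all invariants
that alternate in a nonempty set of slots. -/
theorem mem_of_alternating_of_casimir_mem {M : Submodule ℚ (Tens g m)}
    (hM : ∀ t ∈ spInv g m, ∀ p,
      (fun w => (2 * g + 1) * t w + ∑ i ∈ univ.erase p, t (w ∘ Equiv.swap p i)) ∈ M)
    (k : ℕ) (S : Finset (Fin m)) (hS : S.Nonempty) (hk : #S + k = 2 * g + 1)
    {t : Tens g m} (ht : t ∈ spInv g m)
    (halt : ∀ a ∈ S, ∀ b ∈ S, a ≠ b → ∀ w, t (w ∘ Equiv.swap a b) = -t w) : t ∈ M := by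
  induction k generalizing S t with
  | zero =>
    suffices t = 0 from this ▸ M.zero_mem
    funext w
    obtain ⟨a, ha, b, hb, hab, hw⟩ := exists_ne_map_eq_of_card_lt_of_maps_to
      (s := S) (t := univ) (f := w) (by rw [card_univ, Fintype.card_fin]; omega) (by simp)
    have h := halt a ha b hb hab w
    rw [Equiv.comp_swap_eq_update, hw, Function.update_eq_self, ← hw, Function.update_eq_self] at h
    change t w = 0
    linarith
  | succ k ih =>
    have hj : ∀ j ∈ Sᶜ, (fun w => t w - ∑ i ∈ S, t (w ∘ Equiv.swap i j)) ∈ M := by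
      intro j hjS
      rw [mem_compl] at hjS
      refine ih (insert j S) (insert_nonempty _ _) (by rw [card_insert_of_notMem hjS]; omega)
        ?_ ?_
      · have h : (fun w => t w - ∑ i ∈ S, t (w ∘ Equiv.swap i j)) =
            t - ∑ i ∈ S, fun w => t (w ∘ Equiv.swap i j) := by
          funext w; simp
        rw [h]
        exact sub_mem ht (sum_mem fun i _ => comp_perm_mem_spInv ht _)
      · have hin : ∀ a ∈ S, ∀ b ∈ S, a ≠ b → ∀ w,
            t (w ∘ Equiv.swap a b) - ∑ i ∈ S, t ((w ∘ Equiv.swap a b) ∘ Equiv.swap i j) =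
              -(t w - ∑ i ∈ S, t (w ∘ Equiv.swap i j)) := by
          intro a ha b hb hab w
          have hsum : ∑ i ∈ S, t ((w ∘ Equiv.swap a b) ∘ Equiv.swap i j) =
              ∑ i ∈ S, -t (w ∘ Equiv.swap i j) := by
            refine sum_equiv (Equiv.swap a b) (fun i => ?_) fun i hi => ?_
            · rcases eq_or_ne i a with rfl | hia
              · simp [ha, hb]
              rcases eq_or_ne i b with rfl | hib
              · simp [ha, hb]
              rw [Equiv.swap_apply_of_ne_of_ne hia hib]
            · rw [← halt a ha b hb hab]
              congr 1
              have hja : j ≠ a := fun h => hjS (h ▸ ha)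
              have hjb : j ≠ b := fun h => hjS (h ▸ hb)
              have h := Equiv.swap_apply_apply (Equiv.swap a b) i j
              rw [Equiv.swap_apply_of_ne_of_ne hja hjb] at h
              rw [h]
              funext x
              simp
          rw [hsum, halt a ha b hb hab, sum_neg_distrib]
          ring
        have hjn : ∀ a ∈ S, ∀ w,
            t (w ∘ Equiv.swap a j) - ∑ i ∈ S, t ((w ∘ Equiv.swap a j) ∘ Equiv.swap i j) =
              -(t w - ∑ i ∈ S, t (w ∘ Equiv.swap i j)) := by
          intro a ha w
          have hja : j ≠ a := fun h => hjS (h ▸ ha)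
          rw [← add_sum_erase _ _ ha, ← add_sum_erase _ (fun i => t (w ∘ Equiv.swap i j)) ha]
          have hself : (w ∘ Equiv.swap a j) ∘ Equiv.swap a j = w := by
            funext x; simp
          have hsum : ∑ i ∈ S.erase a, t ((w ∘ Equiv.swap a j) ∘ Equiv.swap i j) =
              ∑ i ∈ S.erase a, -t (w ∘ Equiv.swap i j) := by
            refine sum_congr rfl fun i hi => ?_
            have hia := ne_of_mem_erase hi
            have hji : j ≠ i := fun h => hjS (h ▸ mem_of_mem_erase hi)
            rw [← halt i (mem_of_mem_erase hi) a ha hia]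
            congr 1
            have h := Equiv.swap_apply_apply (Equiv.swap i j) a i
            rw [Equiv.swap_apply_of_ne_of_ne hia.symm hja.symm, Equiv.swap_apply_left] at h
            rw [h, Equiv.swap_comm i a]
            funext x
            simp
          rw [hself, hsum, sum_neg_distrib]
          ring
        intro a ha b hb hab w
        rcases mem_insert.1 ha with rfl | haS <;> rcases mem_insert.1 hb with rfl | hbS
        · exact absurd rfl hab
        · rw [Equiv.swap_comm]
          exact hjn b hbS w
        · exact hjn a haS w
        · exact hin a haS b hbS hab w
    have hsplit : ∀ p ∈ S, ∀ w, ∑ i ∈ univ.erase p, t (w ∘ Equiv.swap p i) =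
        -(#S - 1) * t w + ∑ j ∈ Sᶜ, t (w ∘ Equiv.swap p j) := by
      intro p hp w
      have : univ.erase p = S.erase p ∪ Sᶜ := by
        ext i
        by_cases hi : i ∈ S <;> simp [hi]
        rintro rfl
        exact hi hp
      rw [this, sum_union (disjoint_compl_right.mono_left (erase_subset _ _)),
        sum_congr rfl fun i hi => halt p hp i (mem_of_mem_erase hi) (ne_of_mem_erase hi).symm w,
        sum_const, card_erase_of_mem hp, nsmul_eq_mul, Nat.cast_sub (card_pos.2 ⟨p, hp⟩)]
      push_cast
      ring
    have hmem := add_mem (sum_mem hj) (sum_mem fun p (_ : p ∈ S) => hM t ht p)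
    have hcard : (#Sᶜ : ℚ) = m - #S := by
      rw [card_compl, Fintype.card_fin, Nat.cast_sub (by simpa using card_le_univ S)]
    have heq : (∑ j ∈ Sᶜ, fun w => t w - ∑ i ∈ S, t (w ∘ Equiv.swap i j)) +
        ∑ p ∈ S, (fun w => (2 * g + 1) * t w + ∑ i ∈ univ.erase p, t (w ∘ Equiv.swap p i)) =
        ((m - #S : ℚ) + #S * (2 * g + 2 - #S)) • t := by
      funext w
      simp only [Pi.add_apply, Finset.sum_apply, Pi.smul_apply, smul_eq_mul]
      rw [sum_congr rfl fun p hp => congrArg _ (hsplit p hp w), sum_sub_distrib, sum_add_distrib,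
        sum_add_distrib, sum_comm (s := S)]
      simp only [sum_const, nsmul_eq_mul, hcard]
      ring
    rw [heq] at hmem
    refine (M.smul_mem_iff ?_).1 hmem
    have h1 : (1 : ℚ) ≤ #S := by exact_mod_cast card_pos.2 hS
    have h2 : (#S : ℚ) ≤ m := by exact_mod_cast (by simpa using card_le_univ S)
    have h3 : (#S : ℚ) ≤ 2 * g := by exact_mod_cast (by omega : #S ≤ 2 * g)
    nlinarith

theorem spInv_le_of_casimir_mem [NeZero m] {M : Submodule ℚ (Tens g m)}
    (hM : ∀ t ∈ spInv g m, ∀ p,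
      (fun w => (2 * g + 1) * t w + ∑ i ∈ univ.erase p, t (w ∘ Equiv.swap p i)) ∈ M) :
    spInv g m ≤ M := fun t ht =>
  mem_of_alternating_of_casimir_mem hM (2 * g) {0} (singleton_nonempty _)
    (by rw [card_singleton, add_comm]) ht fun a ha b hb hab =>
      absurd ((mem_singleton.1 ha).trans (mem_singleton.1 hb).symm) hab

/-- The contraction of the slots `p` and `p.succAbove i`. -/
def contract (t : Tens g (m + 2)) (p : Fin (m + 2)) (i : Fin (m + 1)) : Tens g m :=
  fun v => ∑ a, ∑ b, omegaB g a b * t (p.insertNth a (i.insertNth b v))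

theorem contractAt_succAbove (t : Tens g (m + 2)) (p : Fin (m + 2)) (i : Fin (m + 1))
    (w : Fin (m + 2) → Fin (2 * g)) :
    contractAt t p (p.succAbove i) w =
      contract t p i fun k => w (p.succAbove (i.succAbove k)) := by
  refine sum_congr rfl fun a _ => sum_congr rfl fun b _ => ?_
  congr 2
  symm
  rw [Fin.insertNth_eq_iff]
  refine ⟨by simp, ?_⟩
  rw [Fin.insertNth_eq_iff]
  refine ⟨by simp [Fin.removeNth], ?_⟩
  funext k
  simp [Fin.removeNth, Fin.succAbove_ne]

theorem sum_insertNth_insertNth (p : Fin (m + 2)) (i : Fin (m + 1))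
    (G : (Fin (m + 2) → Fin (2 * g)) → ℚ) :
    ∑ w, G w = ∑ a, ∑ b, ∑ v, G (p.insertNth a (i.insertNth b v)) := by
  rw [← (Fin.insertNthEquiv (fun _ => Fin (2 * g)) p).sum_comp, Fintype.sum_prod_type]
  refine sum_congr rfl fun a _ => ?_
  rw [← (Fin.insertNthEquiv (fun _ => Fin (2 * g)) i).sum_comp, Fintype.sum_prod_type]
  rfl

theorem contract_mem_spInv {t : Tens g (m + 2)} (ht : t ∈ spInv g (m + 2)) (p : Fin (m + 2))
    (i : Fin (m + 1)) : contract t p i ∈ spInv g m := by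
  intro f hf
  funext v'
  have hL : tensMapF f (contract t p i) v' = ∑ a, ∑ b, ∑ v,
      omegaB g a b * (t (p.insertNth a (i.insertNth b v)) * ∏ k, f (stdB g (v k)) (v' k)) := by
    simp only [tensMapF, contract, sum_mul]
    rw [sum_comm]
    refine sum_congr rfl fun a _ => ?_
    rw [sum_comm]
    exact sum_congr rfl fun b _ => sum_congr rfl fun v _ => by ring
  have hR : contract t p i v' = ∑ a', ∑ b', ∑ a, ∑ b, ∑ v, omegaB g a' b' *
      (t (p.insertNth a (i.insertNth b v)) * (f (stdB g a) a' * (f (stdB g b) b' *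
        ∏ k, f (stdB g (v k)) (v' k)))) := by
    refine sum_congr rfl fun a' _ => sum_congr rfl fun b' _ => ?_
    conv_lhs => rw [← ht f hf]
    simp only [tensMapF, sum_insertNth_insertNth p i, mul_sum]
    refine sum_congr rfl fun a _ => sum_congr rfl fun b _ => sum_congr rfl fun v _ => ?_
    rw [Fin.prod_univ_succAbove _ p, Fin.prod_univ_succAbove _ i]
    simp
  have hcomm : ∀ {α : Type} [Fintype α] (H : Fin (2 * g) → Fin (2 * g) → α → ℚ),
      ∑ a', ∑ b', ∑ x, H a' b' x = ∑ x, ∑ a', ∑ b', H a' b' x := by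
    intro α _ H
    rw [sum_comm (s := (univ : Finset α))]
    exact sum_congr rfl fun a' _ => sum_comm
  rw [hL, hR]
  symm
  rw [hcomm]
  refine sum_congr rfl fun a _ => ?_
  rw [hcomm]
  refine sum_congr rfl fun b _ => ?_
  rw [hcomm]
  refine sum_congr rfl fun v _ => ?_
  rw [← sum_omegaB_apply f hf a b, sum_mul]
  refine sum_congr rfl fun a' _ => ?_
  rw [sum_mul]
  exact sum_congr rfl fun b' _ => by ring

end FirstFundamentalTheorem

/-! ## Chord tensors -/

section ChordTensor
variable {g m : ℕ} {ι κ : Type*}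

/-- The product of the forms `ω(w a, w b)` over the chords `(a, b)` in `l`. -/
def chordProd (g : ℕ) (l : List (ι × ι)) (w : ι → Fin (2 * g)) : ℚ :=
  (l.map fun c => omegaB g (w c.1) (w c.2)).prod

theorem chordProd_cons (c : ι × ι) (l : List (ι × ι)) (w : ι → Fin (2 * g)) :
    chordProd g (c :: l) w = omegaB g (w c.1) (w c.2) * chordProd g l w := by
  simp [chordProd]

theorem chordProd_map (f : κ → ι) (l : List (κ × κ)) (w : ι → Fin (2 * g)) :
    chordProd g (l.map (Prod.map f f)) w = chordProd g l (w ∘ f) := by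
  simp [chordProd, Function.comp_def]

theorem chordProd_perm {l l' : List (ι × ι)} (h : l.Perm l') (w : ι → Fin (2 * g)) :
    chordProd g l w = chordProd g l' w :=
  (h.map _).prod_eq

/-- The list of end points of a list of chords. -/
def endpoints (l : List (ι × ι)) : List ι := l.flatMap fun c => [c.1, c.2]

theorem endpoints_cons (c : ι × ι) (l : List (ι × ι)) :
    endpoints (c :: l) = c.1 :: c.2 :: endpoints l := rfl

theorem endpoints_map (f : κ → ι) (l : List (κ × κ)) :
    endpoints (l.map (Prod.map f f)) = (endpoints l).map f := by
  induction l with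
  | nil => rfl
  | cons c l ih => simp [endpoints_cons, ih]

theorem endpoints_perm {l l' : List (ι × ι)} (h : l.Perm l') :
    (endpoints l).Perm (endpoints l') :=
  h.flatMap_right _

theorem sum_omegaB_apply' (f : HH g ≃ₗ[ℚ] HH g) (hf : f ∈ SpSet g) (a' b' : Fin (2 * g)) :
    ∑ a, ∑ b, omegaB g a b * (f (stdB g a) a' * f (stdB g b) b') = omegaB g a' b' := by
  let B : Matrix (Fin (2 * g)) (Fin (2 * g)) ℚ := Matrix.of (omegaB g)
  let F : Matrix (Fin (2 * g)) (Fin (2 * g)) ℚ := Matrix.of fun c a => f (stdB g a) c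
  have hB : B.transpose * B = 1 := by
    ext a b
    simp [B, Matrix.mul_apply, Matrix.one_apply, sum_omegaB_mul_omegaB]
  have hBt : B.transpose = -B := by
    ext a b
    simp [B, omegaB_swap a b]
  have hF : F.transpose * (B * F) = B := by
    ext a b
    simp only [B, F, Matrix.mul_apply, Matrix.transpose_apply, Matrix.of_apply, mul_sum]
    rw [← sum_omegaB_apply f hf]
    exact sum_congr rfl fun a' _ => sum_congr rfl fun b' _ => by ring
  have h1 : F * (B.transpose * F.transpose * B) = 1 := by
    rw [mul_eq_one_comm, Matrix.mul_assoc, Matrix.mul_assoc, hF, hB]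
  have h2 : F * B * F.transpose = B := by
    have h3 : (F * B * F.transpose) * B.transpose = 1 := by
      rw [hBt] at h1 ⊢
      simpa [Matrix.mul_assoc] using h1
    have h4 := congrArg (· * B) h3
    simpa [Matrix.mul_assoc, hB] using h4
  have h := congrFun (congrFun h2 a') b'
  simp only [B, F, Matrix.mul_apply, Matrix.transpose_apply, Matrix.of_apply, sum_mul] at h
  rw [← h, sum_comm]
  exact sum_congr rfl fun b _ => sum_congr rfl fun a _ => by ring

theorem omegaB_mul_mem_spInv {s : Tens g m} (hs : s ∈ spInv g m) (p : Fin (m + 2))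
    (i : Fin (m + 1)) :
    (fun w => omegaB g (w p) (w (p.succAbove i)) *
      s fun k => w (p.succAbove (i.succAbove k))) ∈ spInv g (m + 2) := by
  intro f hf
  funext w'
  have h := congrFun (hs f hf) fun k => w' (p.succAbove (i.succAbove k))
  simp only [tensMapF] at h ⊢
  rw [← h, ← sum_omegaB_apply' f hf, sum_insertNth_insertNth p i]
  simp only [sum_mul]
  refine sum_congr rfl fun a _ => sum_congr rfl fun b _ => ?_
  rw [mul_sum]
  refine sum_congr rfl fun v _ => ?_
  rw [Fin.prod_univ_succAbove _ p, Fin.prod_univ_succAbove _ i]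
  simp
  ring

theorem endpoints_map_perm_finRange (p : Fin (m + 2)) (i : Fin (m + 1))
    (l : List (Fin m)) :
    (p :: p.succAbove i :: l.map fun k => p.succAbove (i.succAbove k)).Perm
      (List.finRange (m + 2)) ↔ l.Perm (List.finRange m) := by
  have hfin : (List.finRange (m + 2)).Perm
      (p :: p.succAbove i :: (List.finRange m).map fun k => p.succAbove (i.succAbove k)) := by
    refine (List.perm_ext_iff_of_nodup (List.nodup_finRange _) ?_).2 ?_
    · have h := Fin.succAbove_right_injective (p := p)
      have h' := Fin.succAbove_right_injective (p := i)
      simp only [List.nodup_cons, List.mem_cons, List.mem_map, List.mem_finRange, true_and]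
      refine ⟨?_, ?_, (List.nodup_finRange m).map (h.comp h')⟩
      · rintro (h | ⟨k, hk⟩)
        · exact Fin.succAbove_ne p i h.symm
        · exact Fin.succAbove_ne p _ hk
      · rintro ⟨k, hk⟩
        exact Fin.succAbove_ne i k (h hk)
    · intro a
      simp only [List.mem_cons, List.mem_map, List.mem_finRange, true_and, true_iff]
      rcases eq_or_ne a p with rfl | ha
      · exact Or.inl rfl
      obtain ⟨j, rfl⟩ := Fin.exists_succAbove_eq ha
      rcases eq_or_ne j i with rfl | hj
      · exact Or.inr (Or.inl rfl)
      obtain ⟨k, rfl⟩ := Fin.exists_succAbove_eq hj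
      exact Or.inr (Or.inr ⟨k, rfl⟩)
  rw [(hfin.congr_right _), List.perm_cons, List.perm_cons]
  exact List.map_perm_map_iff
    (Fin.succAbove_right_injective.comp Fin.succAbove_right_injective)

theorem chordProd_mem_spInv : ∀ {m : ℕ} (l : List (Fin m × Fin m)),
    (endpoints l).Perm (List.finRange m) → chordProd g l ∈ spInv g m
  | 0, [], _ => fun f _ => by
    funext w
    simp [tensMapF, chordProd]
  | 1, [], hl => absurd hl.length_eq (by simp [endpoints])
  | _ + 2, [], hl => absurd hl.length_eq (by simp [endpoints])
  | 0, c :: _, _ => c.1.elim0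
  | 1, _ :: _, hl => absurd hl.length_eq (by simp [endpoints_cons])
  | m + 2, (p, q) :: l, hl => by
    have hnd := hl.nodup_iff.2 (List.nodup_finRange _)
    simp only [endpoints_cons, List.nodup_cons, List.mem_cons, not_or] at hnd
    obtain ⟨i, rfl⟩ := Fin.exists_succAbove_eq (Ne.symm hnd.1.1)
    have hr : ∀ x ∈ endpoints l, x ∈ Set.range fun k => p.succAbove (i.succAbove k) := by
      intro x hx
      obtain ⟨j, rfl⟩ := Fin.exists_succAbove_eq (x := x) (y := p) (by
        rintro rfl; exact hnd.1.2 hx)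
      obtain ⟨k, rfl⟩ := Fin.exists_succAbove_eq (x := j) (y := i) (by
        rintro rfl; exact hnd.2.1 hx)
      exact ⟨k, rfl⟩
    have hl' : l ∈ Set.range (List.map
        (Prod.map (fun k => p.succAbove (i.succAbove k)) fun k => p.succAbove (i.succAbove k))) := by
      rw [Set.range_list_map]
      rintro ⟨x, y⟩ hc
      obtain ⟨x', hx⟩ := hr x (List.mem_flatMap.2 ⟨_, hc, by simp⟩)
      obtain ⟨y', hy⟩ := hr y (List.mem_flatMap.2 ⟨_, hc, by simp⟩)
      exact ⟨(x', y'), Prod.ext hx hy⟩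
    obtain ⟨l', rfl⟩ := hl'
    rw [endpoints_cons, endpoints_map, endpoints_map_perm_finRange] at hl
    convert omegaB_mul_mem_spInv (chordProd_mem_spInv l' hl) p i using 1
    funext w
    rw [chordProd_cons, chordProd_map]
    rfl

/-- The first fundamental theorem of invariant theory for the symplectic group. -/
theorem spInv_le_span_chordProd : ∀ m, spInv g m ≤ Submodule.span ℚ
    {t | ∃ l : List (Fin m × Fin m), (endpoints l).Perm (List.finRange m) ∧ t = chordProd g l}
  | 0 => fun t _ => by
    have : t = t Fin.elim0 • chordProd g [] := by
      funext w
      rw [Subsingleton.elim w Fin.elim0]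
      simp [chordProd]
    rw [this]
    exact Submodule.smul_mem _ _ (Submodule.subset_span ⟨[], by simp [endpoints], rfl⟩)
  | 1 => spInv_le_of_casimir_mem fun t ht p => by
    have : (fun w => (2 * g + 1) * t w + ∑ i ∈ univ.erase p, t (w ∘ Equiv.swap p i)) = 0 := by
      funext w
      rw [casimir_slot ht]
      exact sum_eq_zero fun i hi => absurd (Subsingleton.elim i p) (ne_of_mem_erase hi)
    rw [this]
    exact zero_mem _
  | m + 2 => spInv_le_of_casimir_mem fun t ht p => by
    have heq : (fun w => (2 * g + 1) * t w + ∑ i ∈ univ.erase p, t (w ∘ Equiv.swap p i)) =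
        ∑ i : Fin (m + 1), fun w => omegaB g (w p) (w (p.succAbove i)) *
          contract t p i fun k => w (p.succAbove (i.succAbove k)) := by
      funext w
      rw [casimir_slot ht, Finset.sum_apply]
      simp only [← contractAt_succAbove]
      refine (sum_bij (fun i _ => p.succAbove i) ?_ ?_ ?_ ?_).symm
      · simp [Fin.succAbove_ne]
      · exact fun i _ j _ h => Fin.succAbove_right_injective h
      · intro b hb
        obtain ⟨i, hi⟩ := Fin.exists_succAbove_eq (ne_of_mem_erase hb)
        exact ⟨i, mem_univ _, hi⟩
      · exact fun _ _ => rfl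
    rw [heq]
    refine sum_mem fun i _ => ?_
    have hs := spInv_le_span_chordProd m (contract_mem_spInv ht p i)
    generalize contract t p i = s at hs
    induction hs using Submodule.span_induction with
    | mem s hs =>
      obtain ⟨l, hl, rfl⟩ := hs
      refine Submodule.subset_span ⟨(p, p.succAbove i) ::
        l.map (Prod.map (fun k => p.succAbove (i.succAbove k)) fun k => p.succAbove (i.succAbove k)),
        ?_, ?_⟩
      · rw [endpoints_cons, endpoints_map]
        exact (endpoints_map_perm_finRange p i _).2 hl
      · funext w
        rw [chordProd_cons, chordProd_map]
        rfl
    | zero =>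
      simp only [Pi.zero_apply, mul_zero]
      exact Submodule.zero_mem _
    | add x y _ _ hx hy =>
      convert add_mem hx hy using 1
      funext w
      simp [mul_add]
    | smul c x _ hx =>
      convert Submodule.smul_mem _ c hx using 1
      funext w
      simp [mul_left_comm]

/-- The perfect matchings of a list of points, found by matching the first point with each of the
others; the first argument bounds the number of chords. -/
def matchings [DecidableEq ι] : ℕ → List ι → List (List (ι × ι))
  | 0, _ => [[]]
  | _ + 1, [] => [[]]
  | n + 1, a :: r => r.flatMap fun b => (matchings n (r.erase b)).map ((a, b) :: ·)

theorem exists_mem_matchings [DecidableEq ι] (n : ℕ) (L : List ι) (hn : L.length ≤ 2 * n)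
    (l : List (ι × ι)) (hl : (endpoints l).Perm L) :
    ∃ l' ∈ matchings n L, (∀ w, chordProd g l w = chordProd g l' w) ∨
      ∀ w, chordProd g l w = -chordProd g l' w := by
  induction n generalizing L l with
  | zero =>
    obtain rfl : L = [] := List.length_eq_zero_iff.1 (by omega)
    cases l with
    | nil => exact ⟨[], by simp [matchings], Or.inl fun _ => rfl⟩
    | cons c l => simp [endpoints_cons] at hl
  | succ n ih =>
    cases L with
    | nil =>
      cases l with
      | nil => exact ⟨[], by simp [matchings], Or.inl fun _ => rfl⟩
      | cons c l => simp [endpoints_cons] at hl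
    | cons a r =>
      have key : ∀ (b : ι) (l₁ : List (ι × ι)), (endpoints l₁).Perm (r.erase b) → b ∈ r →
          ∃ l' ∈ matchings (n + 1) (a :: r),
            (∀ w, chordProd g ((a, b) :: l₁) w = chordProd g l' w) ∨
              ∀ w, chordProd g ((a, b) :: l₁) w = -chordProd g l' w := by
        intro b l₁ h₁ hb
        obtain ⟨l', hl', h⟩ := ih (r.erase b) (by
          rw [List.length_erase_of_mem hb]; simp at hn; omega) l₁ h₁
        refine ⟨(a, b) :: l', ?_, ?_⟩
        · simp only [matchings, List.mem_flatMap, List.mem_map]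
          exact ⟨b, hb, l', hl', rfl⟩
        · refine h.imp (fun h w => ?_) fun h w => ?_ <;> rw [chordProd_cons, chordProd_cons, h]
          ring
      have ha : a ∈ endpoints l := hl.mem_iff.2 List.mem_cons_self
      obtain ⟨⟨x, y⟩, hc, hac⟩ := List.mem_flatMap.1 ha
      have hp := List.perm_cons_erase hc
      have hl2 := (endpoints_perm hp).symm.trans hl
      rw [endpoints_cons] at hl2
      simp only [chordProd_perm hp]
      simp only [List.mem_cons, List.not_mem_nil, or_false] at hac
      rcases hac with rfl | rfl
      · have h := hl2.cons_inv
        have hb : y ∈ r := h.mem_iff.1 List.mem_cons_self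
        exact key y _ ((List.cons_perm_iff_perm_erase.1 h).2) hb
      · have h := ((List.Perm.swap _ _ _).trans hl2).cons_inv
        have hb : x ∈ r := h.mem_iff.1 List.mem_cons_self
        obtain ⟨l', hl', h'⟩ := key x _ ((List.cons_perm_iff_perm_erase.1 h).2) hb
        refine ⟨l', hl', h'.symm.imp (fun h w => ?_) fun h w => ?_⟩ <;>
          rw [chordProd_cons] at * <;> simp only [chordProd_cons] at h <;>
          rw [omegaB_swap] <;> linarith [h w]

end ChordTensor

/-! ## The Dynkin operator -/

section Dynkin
attribute [local instance] LieRing.ofAssociativeRing LieAlgebra.ofAssociativeAlgebra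

variable {g m n : ℕ}

/-- Application of a linear map to all slots but the first. -/
def liftL (F : Tens g m →ₗ[ℚ] Tens g n) : Tens g (m + 1) →ₗ[ℚ] Tens g (n + 1) where
  toFun t w := F (fun v => t (Fin.cons (w 0) v)) (Fin.tail w)
  map_add' s t := by
    funext w
    exact congrFun (F.map_add (fun v => s (Fin.cons (w 0) v)) fun v => t (Fin.cons (w 0) v)) _
  map_smul' c t := by
    funext w
    exact congrFun (F.map_smul c fun v => t (Fin.cons (w 0) v)) _

/-- The Dynkin operator, sending a pure tensor to the left-normed bracket of its factors. -/
def dynkin (g : ℕ) : (m : ℕ) → Tens g (m + 1) →ₗ[ℚ] Tens g (m + 1)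
  | 0 => LinearMap.id
  | m + 1 => betaL g (m + 1) ∘ₗ liftL (dynkin g m)

/-- The tensor `ξ ⊗ u`. -/
def tmulOne (ξ : Tens g m) (u : HH g) : Tens g (m + 1) :=
  fun w => ξ (fun i => w i.castSucc) * u (w (Fin.last m))

theorem oneBrkt_eq_sub (u : HH g) (ξ : Tens g m) : oneBrkt u ξ = oneTmul u ξ - tmulOne ξ u := rfl

theorem betaL_oneTmul (u : HH g) (ξ : Tens g m) : betaL g m (oneTmul u ξ) = oneBrkt u ξ := by
  funext w
  simp [betaL, betaFun, oneTmul, oneBrkt, mul_comm]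

theorem liftL_eq_sum (F : Tens g m →ₗ[ℚ] Tens g n) (t : Tens g (m + 1)) :
    liftL F t = ∑ a, oneTmul (stdB g a) (F fun v => t (Fin.cons a v)) := by
  funext w
  simp [liftL, oneTmul, stdB, Finset.sum_apply]
  rfl

theorem dynkin_succ (t : Tens g (m + 2)) :
    dynkin g (m + 1) t = ∑ a, oneBrkt (stdB g a) (dynkin g m fun v => t (Fin.cons a v)) := by
  simp only [dynkin, LinearMap.comp_apply, liftL_eq_sum, map_sum, betaL_oneTmul]

theorem oneBrkt_mem_Lsub (u : HH g) {ξ : Tens g (m + 1)} (hξ : ξ ∈ Lsub g m) :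
    oneBrkt u ξ ∈ Lsub g (m + 1) := by
  induction hξ using Submodule.span_induction with
  | mem ξ h =>
    obtain ⟨v, rfl⟩ := h
    exact Submodule.subset_span ⟨Fin.cons u v, rfl⟩
  | zero =>
    convert Submodule.zero_mem _
    funext w
    simp [oneBrkt]
  | add ξ η _ _ hξ hη =>
    convert Submodule.add_mem _ hξ hη using 1
    funext w
    simp [oneBrkt]
    ring
  | smul c ξ _ hξ =>
    convert Submodule.smul_mem _ c hξ using 1
    funext w
    simp [oneBrkt]
    ring

theorem dynkin_mem_Lsub : ∀ (m : ℕ) (t : Tens g (m + 1)), dynkin g m t ∈ Lsub g m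
  | 0, t => by
    have : t = leftNormed g 0 fun _ a => t fun _ => a := by
      funext w
      exact congrArg t (funext fun i => by rw [Fin.fin_one_eq_zero i])
    rw [dynkin, LinearMap.id_apply, this]
    exact Submodule.subset_span ⟨_, rfl⟩
  | m + 1, t => by
    rw [dynkin_succ]
    exact sum_mem fun a _ => oneBrkt_mem_Lsub _ (dynkin_mem_Lsub m _)

theorem liftL_dynkin_mem_HLsub (t : Tens g (m + 2)) : liftL (dynkin g m) t ∈ HLsub g m := by
  rw [liftL_eq_sum]
  exact sum_mem fun a _ => Submodule.subset_span ⟨_, _, dynkin_mem_Lsub m _, rfl⟩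

/-- The tensor algebra of `HH g`. -/
abbrev WordAlg (g : ℕ) := MonoidAlgebra ℚ (FreeMonoid (Fin (2 * g)))

/-- A tensor as an element of the tensor algebra. -/
def toWordAlg (g m : ℕ) : Tens g m →ₗ[ℚ] WordAlg g where
  toFun t := ∑ w, MonoidAlgebra.single (FreeMonoid.ofList (List.ofFn w)) (t w)
  map_add' s t := by simp [sum_add_distrib]
  map_smul' c t := by simp [smul_sum]

theorem toWordAlg_injective : Function.Injective (toWordAlg g m) := by
  intro s t h
  funext w
  classical
  have key : ∀ t : Tens g m, (toWordAlg g m t).coeff (FreeMonoid.ofList (List.ofFn w)) = t w := by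
    intro t
    simp only [toWordAlg, LinearMap.coe_mk, AddHom.coe_mk, MonoidAlgebra.coeff_sum,
      MonoidAlgebra.coeff_single, Finsupp.finsetSum_apply, Finsupp.single_apply,
      EmbeddingLike.apply_eq_iff_eq, List.ofFn_inj, sum_ite_eq', mem_univ, if_true]
  rw [← key s, ← key t, h]

theorem toWordAlg_zero (t : Tens g 0) : toWordAlg g 0 t = t default • 1 := by
  simp [toWordAlg, MonoidAlgebra.one_def]

/-- A letter as an element of the tensor algebra. -/
def letter (a : Fin (2 * g)) : WordAlg g := MonoidAlgebra.single (FreeMonoid.of a) 1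

theorem toWordAlg_succ (t : Tens g (m + 1)) :
    toWordAlg g (m + 1) t = ∑ a, letter a * toWordAlg g m fun v => t (Fin.cons a v) := by
  simp only [toWordAlg, LinearMap.coe_mk, AddHom.coe_mk, mul_sum]
  rw [← (Fin.consEquiv fun _ => Fin (2 * g)).sum_comp, Fintype.sum_prod_type]
  refine sum_congr rfl fun a _ => sum_congr rfl fun v _ => ?_
  simp [letter, MonoidAlgebra.single_mul_single, Fin.consEquiv]

/-- A vector as an element of the tensor algebra. -/
def vec (u : HH g) : WordAlg g := ∑ a, u a • letter a

theorem toWordAlg_oneTmul (u : HH g) (ξ : Tens g m) :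
    toWordAlg g (m + 1) (oneTmul u ξ) = vec u * toWordAlg g m ξ := by
  rw [toWordAlg_succ, vec, sum_mul]
  refine sum_congr rfl fun a _ => ?_
  rw [smul_mul_assoc, ← mul_smul_comm, ← map_smul]
  rfl

theorem toWordAlg_tmulOne (ξ : Tens g m) (u : HH g) :
    toWordAlg g (m + 1) (tmulOne ξ u) = toWordAlg g m ξ * vec u := by
  simp only [toWordAlg, LinearMap.coe_mk, AddHom.coe_mk, vec, sum_mul, mul_sum]
  rw [← (Fin.snocEquiv fun _ => Fin (2 * g)).sum_comp, Fintype.sum_prod_type]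
  refine sum_congr rfl fun a _ => sum_congr rfl fun v _ => ?_
  rw [letter, MonoidAlgebra.smul_single, MonoidAlgebra.single_mul_single, List.ofFn_succ']
  simp [tmulOne, Fin.snocEquiv]

theorem toWordAlg_oneBrkt (u : HH g) (ξ : Tens g m) :
    toWordAlg g (m + 1) (oneBrkt u ξ) = ⁅vec u, toWordAlg g m ξ⁆ := by
  rw [oneBrkt_eq_sub, map_sub, toWordAlg_oneTmul, toWordAlg_tmulOne, Ring.lie_def]

theorem vec_stdB (a : Fin (2 * g)) : vec (stdB g a) = letter a := by
  simp [vec, stdB]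

/-- The action of the tensor algebra on itself extending the adjoint action of the letters. -/
def adAlg (g : ℕ) : WordAlg g →ₐ[ℚ] Module.End ℚ (WordAlg g) :=
  MonoidAlgebra.lift ℚ _ _ (FreeMonoid.lift fun a => LieAlgebra.ad ℚ (WordAlg g) (letter a))

theorem adAlg_letter (a : Fin (2 * g)) :
    adAlg g (letter a) = LieAlgebra.ad ℚ (WordAlg g) (letter a) := by
  simp [adAlg, letter]

theorem adAlg_vec (u : HH g) : adAlg g (vec u) = LieAlgebra.ad ℚ (WordAlg g) (vec u) := by
  simp [vec, adAlg_letter]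

theorem toWordAlg_leftNormed_zero (u : Fin 1 → HH g) :
    toWordAlg g 1 (leftNormed g 0 u) = vec (u 0) := by
  have h : leftNormed g 0 u = oneTmul (u 0) fun _ => 1 := by
    funext w
    simp [leftNormed, oneTmul]
  rw [h, toWordAlg_oneTmul, toWordAlg_zero, one_smul, mul_one]

theorem adAlg_leftNormed : ∀ (m : ℕ) (u : Fin (m + 1) → HH g),
    adAlg g (toWordAlg g _ (leftNormed g m u)) =
      LieAlgebra.ad ℚ (WordAlg g) (toWordAlg g _ (leftNormed g m u))
  | 0, u => by rw [toWordAlg_leftNormed_zero, adAlg_vec]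
  | m + 1, u => by
    rw [leftNormed, toWordAlg_oneBrkt, LieHom.map_lie, ← adAlg_leftNormed m, ← adAlg_vec,
      Ring.lie_def, Ring.lie_def, map_sub, map_mul, map_mul]

theorem toWordAlg_dynkin_tmulOne : ∀ (m : ℕ) (s : Tens g m) (u : HH g),
    toWordAlg g _ (dynkin g m (tmulOne s u)) = adAlg g (toWordAlg g m s) (vec u)
  | 0, s, u => by
    change toWordAlg g _ (tmulOne s u) = _
    rw [toWordAlg_tmulOne]
    simp [toWordAlg_zero]
  | m + 1, s, u => by
    rw [dynkin_succ, toWordAlg_succ s, map_sum, map_sum, LinearMap.sum_apply]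
    refine sum_congr rfl fun a _ => ?_
    rw [toWordAlg_oneBrkt, vec_stdB, map_mul, adAlg_letter, Module.End.mul_apply,
      ← toWordAlg_dynkin_tmulOne m, LieAlgebra.ad_apply]
    congr 4
    funext v
    simp only [tmulOne]
    congr 2
    funext i
    cases i using Fin.cases <;> rfl

theorem dynkin_leftNormed : ∀ (m : ℕ) (u : Fin (m + 1) → HH g),
    dynkin g m (leftNormed g m u) = (m + 1 : ℚ) • leftNormed g m u
  | 0, u => by simp [dynkin]
  | m + 1, u => by
    apply toWordAlg_injective
    have h : dynkin g (m + 1) (oneTmul (u 0) (leftNormed g m fun i => u i.succ)) =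
        oneBrkt (u 0) (dynkin g m (leftNormed g m fun i => u i.succ)) := by
      rw [← betaL_oneTmul]
      simp only [dynkin, LinearMap.comp_apply]
      congr 1
      funext w
      change dynkin g m (u 0 (w 0) • leftNormed g m fun i => u i.succ) (Fin.tail w) = _
      rw [map_smul]
      rfl
    rw [leftNormed, map_smul, toWordAlg_oneBrkt, oneBrkt_eq_sub, map_sub, map_sub, h,
      toWordAlg_oneBrkt, toWordAlg_dynkin_tmulOne, adAlg_leftNormed, LieAlgebra.ad_apply,
      dynkin_leftNormed m, map_smul, lie_smul, ← lie_skew (vec (u 0))]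
    push_cast
    module

theorem dynkin_of_mem_Lsub {ξ : Tens g (m + 1)} (hξ : ξ ∈ Lsub g m) :
    dynkin g m ξ = (m + 1 : ℚ) • ξ := by
  have : Lsub g m ≤ LinearMap.eqLocus (dynkin g m) ((m + 1 : ℚ) • LinearMap.id) :=
    Submodule.span_le.2 (by rintro _ ⟨u, rfl⟩; exact dynkin_leftNormed m u)
  exact this hξ

theorem liftL_dynkin_of_mem_HLsub {t : Tens g (m + 2)} (ht : t ∈ HLsub g m) :
    liftL (dynkin g m) t = (m + 1 : ℚ) • t := by
  have : HLsub g m ≤ LinearMap.eqLocus (liftL (dynkin g m)) ((m + 1 : ℚ) • LinearMap.id) := by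
    refine Submodule.span_le.2 ?_
    rintro _ ⟨u, ξ, hξ, rfl⟩
    funext w
    change dynkin g m (u (w 0) • ξ) (Fin.tail w) = (m + 1 : ℚ) * (u (w 0) * ξ (Fin.tail w))
    rw [map_smul, dynkin_of_mem_Lsub hξ]
    simp
    ring
  exact this ht

end Dynkin

/-! ## Permutation actions on tensors -/

section SlotAction
variable {g m : ℕ}

/-- Reindexing of the slots of a tensor. -/
def permL (g : ℕ) (κ : Fin m → Fin m) : Tens g m →ₗ[ℚ] Tens g m :=
  LinearMap.funLeft ℚ ℚ fun w => w ∘ κ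

theorem permL_apply (κ : Fin m → Fin m) (t : Tens g m) (w : Fin m → Fin (2 * g)) :
    permL g κ t w = t (w ∘ κ) := rfl

/-- The cyclic rotation of the slots used in `betaFun`. -/
def cyc (m : ℕ) (i : Fin (m + 1)) : Fin (m + 1) := Fin.cases (Fin.last m) (fun j => j.castSucc) i

/-- The extension of a map of slots by a new first slot, which is fixed. -/
def shiftSlot (κ : Fin m → Fin m) : Fin (m + 1) → Fin (m + 1) := Fin.cons 0 fun i => (κ i).succ

theorem betaL_eq : betaL g m = LinearMap.id - permL g (cyc m) := by
  refine LinearMap.ext fun t => funext fun w => ?_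
  change t w - _ = t w - _
  congr 2
  funext i
  cases i using Fin.cases <;> rfl

theorem liftL_id : liftL (LinearMap.id : Tens g m →ₗ[ℚ] Tens g m) = LinearMap.id := by
  refine LinearMap.ext fun t => funext fun w => ?_
  exact congrArg t (Fin.cons_self_tail w)

theorem liftL_comp {n p : ℕ} (F : Tens g n →ₗ[ℚ] Tens g p) (G : Tens g m →ₗ[ℚ] Tens g n) :
    liftL (F ∘ₗ G) = liftL F ∘ₗ liftL G := by
  refine LinearMap.ext fun t => funext fun w => ?_
  simp [liftL]

theorem liftL_id_sub_permL (κ : Fin m → Fin m) :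
    liftL (LinearMap.id - permL g κ) = LinearMap.id - permL g (shiftSlot κ) := by
  refine LinearMap.ext fun t => funext fun w => ?_
  change t (Fin.cons (w 0) (Fin.tail w)) - t (Fin.cons (w 0) (Fin.tail w ∘ κ)) = t w - t _
  rw [Fin.cons_self_tail]
  congr 2
  funext i
  cases i using Fin.cases <;> rfl

theorem permL_mem_spInv {κ : Fin m → Fin m} (hκ : Function.Bijective κ) {t : Tens g m}
    (ht : t ∈ spInv g m) : permL g κ t ∈ spInv g m :=
  comp_perm_mem_spInv (π := Equiv.ofBijective κ hκ) ht

/-- The sum of all rotations of a tensor with eight slots. -/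
def rotSum (g : ℕ) : Tens g 8 →ₗ[ℚ] Tens g 8 := ∑ k : Fin 8, permL g (· + k)

theorem rotSum_apply (t : Tens g 8) (w : Fin 8 → Fin (2 * g)) :
    rotSum g t w = ∑ k, t fun i => w (i + k) := by
  simp only [rotSum, LinearMap.sum_apply, Finset.sum_apply]
  rfl

theorem cyc_seven (i : Fin 8) : cyc 7 i = i + 7 := by
  revert i
  decide

theorem betaL_rotSum (t : Tens g 8) : betaL g 7 (rotSum g t) = 0 := by
  funext w
  rw [betaL_eq, LinearMap.sub_apply, Pi.sub_apply, permL_apply, LinearMap.id_apply, rotSum_apply,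
    rotSum_apply, Pi.zero_apply, sub_eq_zero,
    ← Equiv.sum_comp (Equiv.addRight (7 : Fin 8)) fun k => t fun i => w (i + k)]
  simp [cyc_seven, add_assoc]

theorem rotSum_eq_of_betaL {t : Tens g 8} (ht : betaL g 7 t = 0) : rotSum g t = (8 : ℚ) • t := by
  have h1 : ∀ w : Fin 8 → Fin (2 * g), t (fun i => w (i + 7)) = t w := fun w => by
    have := congrFun ht w
    rw [betaL_eq, LinearMap.sub_apply, Pi.sub_apply, permL_apply, LinearMap.id_apply,
      Pi.zero_apply, sub_eq_zero] at this
    rw [this]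
    exact congrArg t (funext fun i => congrArg w (cyc_seven i).symm)
  have h2 : ∀ (n : ℕ) (w : Fin 8 → Fin (2 * g)), t (fun i => w (i + n • 7)) = t w := fun n => by
    induction n with
    | zero => simp
    | succ n ih =>
      intro w
      rw [← ih w, ← h1 fun i => w (i + n • 7)]
      simp only [succ_nsmul', add_assoc]
  have h3 : ∀ k : Fin 8, k = (7 * k.val) • (7 : Fin 8) := by decide
  funext w
  rw [rotSum_apply, sum_congr rfl fun k _ => show (t fun i => w (i + k)) = t w by rw [h3 k, h2]]
  simp

end SlotAction

/-! ## Computing with formal sums of chord diagrams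

The functions in this section are meant to be evaluated by the kernel. They are written with
recursors and in continuation-passing style, so that intermediate results get fully evaluated. -/

section ChordSum
variable {g : ℕ} {α : Type}

/-- A formal combination of chord diagrams on eight points, sorted by codes. The code of a diagram
is the decimal number whose digits are the endpoints of its four chords. -/
abbrev ChordSum := List (ℤ × ℕ)

/-- The last chord of the diagram with a given code. -/
def decodeChord (n : ℕ) : Fin 8 × Fin 8 :=
  (Fin.ofNat 8 (n / 10 % 10), Fin.ofNat 8 (n % 10))

/-- The chord diagram with a given code. -/
def decode (n : ℕ) : List (Fin 8 × Fin 8) :=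
  [decodeChord (n / 1000000), decodeChord (n / 10000), decodeChord (n / 100), decodeChord n]

/-- The tensor represented by a formal combination of chord diagrams. -/
def ev (g : ℕ) (s : ChordSum) : Tens g 8 :=
  (s.map fun x => (x.1 : ℚ) • chordProd g (decode x.2)).sum

theorem ev_nil : ev g [] = 0 := rfl

theorem ev_cons (x : ℤ × ℕ) (s : ChordSum) :
    ev g (x :: s) = (x.1 : ℚ) • chordProd g (decode x.2) + ev g s := by
  simp [ev]

theorem ev_mem {S : Submodule ℚ (Tens g 8)} {s : ChordSum}
    (h : ∀ x ∈ s, chordProd g (decode x.2) ∈ S) : ev g s ∈ S :=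
  S.list_sum_mem fun _ ht => by
    obtain ⟨x, hx, rfl⟩ := List.mem_map.1 ht
    exact S.smul_mem _ (h x hx)

/-- Application of a function to an evaluated natural number. -/
def forceNat (n : ℕ) (k : ℕ → α) : α := Nat.rec (k 0) (fun m _ => k m.succ) n

theorem forceNat_eq (n : ℕ) (k : ℕ → α) : forceNat n k = k n := by
  cases n <;> rfl

/-- Application of a function to an evaluated integer. -/
def forceInt (z : ℤ) (k : ℤ → α) : α :=
  Int.rec (fun n => forceNat n fun n => k (.ofNat n))
    (fun n => forceNat n fun n => k (.negSucc n)) z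

theorem forceInt_eq (z : ℤ) (k : ℤ → α) : forceInt z k = k z := by
  cases z with
  | ofNat n => exact forceNat_eq n fun n => k (.ofNat n)
  | negSucc n => exact forceNat_eq n fun n => k (.negSucc n)

/-- Application of a function to an evaluated formal sum. -/
def forceSum (s : ChordSum) (k : ChordSum → α) : α :=
  List.rec (fun k => k [])
    (fun x _ ih k => forceInt x.1 fun c => forceNat x.2 fun n => ih fun s => k ((c, n) :: s)) s k

theorem forceSum_eq (s : ChordSum) (k : ChordSum → α) : forceSum s k = k s := by
  induction s generalizing k with
  | nil => rfl
  | cons x s ih =>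
    change (forceInt x.1 fun c => forceNat x.2 fun n => forceSum s fun s => k ((c, n) :: s)) = _
    rw [forceInt_eq, forceNat_eq, ih]

/-- The sum of two sorted formal sums. -/
def mergeSum (s s' : ChordSum) : ChordSum :=
  List.rec (fun s' => s') (fun x s ih s' => List.rec (x :: s) (fun y s' ih' =>
    bif Nat.beq x.2 y.2 then forceInt (Int.add x.1 y.1) fun z => (z, x.2) :: ih s' else
    bif Nat.ble x.2 y.2 then x :: ih (y :: s') else y :: ih') s') s s'

theorem mergeSum_cons_cons (x y : ℤ × ℕ) (s s' : ChordSum) : mergeSum (x :: s) (y :: s') =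
    bif Nat.beq x.2 y.2 then forceInt (Int.add x.1 y.1) fun z => (z, x.2) :: mergeSum s s' else
    bif Nat.ble x.2 y.2 then x :: mergeSum s (y :: s') else y :: mergeSum (x :: s) s' := rfl

theorem ev_mergeSum (s s' : ChordSum) : ev g (mergeSum s s') = ev g s + ev g s' := by
  induction s generalizing s' with
  | nil => exact (zero_add _).symm
  | cons x s ih =>
    induction s' with
    | nil => exact (add_zero _).symm
    | cons y s' ih' =>
      rw [mergeSum_cons_cons, forceInt_eq]
      cases h : Nat.beq x.2 y.2 with
      | true =>
        rw [cond_true, ev_cons, ev_cons, ev_cons, ih, ← Nat.eq_of_beq_eq_true h]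
        change ((x.1 + y.1 : ℤ) : ℚ) • _ + _ = _
        push_cast
        module
      | false =>
        cases Nat.ble x.2 y.2
        · rw [cond_false, cond_false, ev_cons, ih', ev_cons y]
          abel
        · rw [cond_false, cond_true, ev_cons, ih, ev_cons x]
          abel

/-- Splitting of a formal sum into two parts of about the same length. -/
def splitSum (s : ChordSum) (k : ChordSum → ChordSum → α) : α :=
  List.rec (fun k => k [] []) (fun x _ ih k => ih fun a b => k (x :: b) a) s k

theorem exists_splitSum (s : ChordSum) : ∃ a b : ChordSum, (∀ g, ev g s = ev g a + ev g b) ∧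
    ∀ {α : Type} (k : ChordSum → ChordSum → α), splitSum s k = k a b := by
  induction s with
  | nil => exact ⟨[], [], fun _ => (add_zero _).symm, fun _ => rfl⟩
  | cons x s ih =>
    obtain ⟨a, b, h, hk⟩ := ih
    refine ⟨x :: b, a, fun g => ?_, fun k => hk fun a b => k (x :: b) a⟩
    rw [ev_cons, ev_cons, h, add_assoc, add_comm (ev g b)]

/-- Merge sort of a formal sum with at most `2 ^ n` terms. -/
def sortSum (n : ℕ) (s : ChordSum) : ChordSum :=
  Nat.rec (fun s => s) (fun _ ih s => splitSum s fun a b => mergeSum (ih a) (ih b)) n s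

theorem ev_sortSum (n : ℕ) (s : ChordSum) : ev g (sortSum n s) = ev g s := by
  induction n generalizing s with
  | zero => rfl
  | succ n ih =>
    obtain ⟨a, b, h, hk⟩ := exists_splitSum s
    change ev g (splitSum s fun a b => mergeSum (sortSum n a) (sortSum n b)) = _
    rw [hk, ev_mergeSum, ih, ih, h]

/-- The sign encoded by a boolean. -/
def sgn (b : Bool) : ℚ := bif b then -1 else 1

/-- The image of a chord under a map of endpoints, oriented in increasing order; the boolean keeps
track of the sign. -/
def orient (σ : ℕ → ℕ) (n : ℕ) (b : Bool) (k : Bool → ℕ → α) : α :=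
  forceNat (σ (((n.div 10).mod 10).mod 8)) fun x => forceNat (σ ((n.mod 10).mod 8)) fun y =>
    bif x.ble y then forceNat ((x.mul 10).add y) fun c => k b c
    else forceNat ((y.mul 10).add x) fun c => k (!b) c

/-- The value at a word of the last chord of the diagram with a given code. -/
def chordValue (n : ℕ) (w : Fin 8 → Fin (2 * g)) : ℚ :=
  omegaB g (w (decodeChord n).1) (w (decodeChord n).2)

theorem decodeChord_of_fin (a b : Fin 8) : decodeChord (a.val * 10 + b.val) = (a, b) := by
  revert a b
  decide

theorem exists_orient {σ : ℕ → ℕ} {κ : Fin 8 → Fin 8} (hσ : ∀ i : Fin 8, σ i = κ i) (n : ℕ)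
    (b : Bool) : ∃ (b' : Bool) (c : ℕ), c < 100 ∧
      (∀ {g : ℕ} (w : Fin 8 → Fin (2 * g)),
        sgn b * chordValue n (w ∘ κ) = sgn b' * chordValue c w) ∧
      ∀ {α : Type} (k : Bool → ℕ → α), orient σ n b k = k b' c := by
  obtain ⟨x, hx⟩ : ∃ x, κ (decodeChord n).1 = x := ⟨_, rfl⟩
  obtain ⟨y, hy⟩ : ∃ y, κ (decodeChord n).2 = y := ⟨_, rfl⟩
  have hk : ∀ {α : Type} (k : Bool → ℕ → α), orient σ n b k =
      bif x.val.ble y then k b (x.val * 10 + y) else k (!b) (y.val * 10 + x) := fun k => by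
    have hx' : σ (((n.div 10).mod 10).mod 8) = x := by rw [← hx]; exact hσ (decodeChord n).1
    have hy' : σ ((n.mod 10).mod 8) = y := by rw [← hy]; exact hσ (decodeChord n).2
    rw [orient, forceNat_eq, forceNat_eq, forceNat_eq, forceNat_eq, hx', hy']
    rfl
  cases hxy : x.val.ble y with
  | true =>
    refine ⟨b, x.val * 10 + y, by omega, fun w => ?_, fun k => by rw [hk, hxy, cond_true]⟩
    rw [chordValue, chordValue, decodeChord_of_fin, ← hx, ← hy]
    rfl
  | false =>
    refine ⟨!b, y.val * 10 + x, by omega, fun w => ?_, fun k => by rw [hk, hxy, cond_false]⟩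
    rw [chordValue, chordValue, decodeChord_of_fin, ← hx, ← hy, omegaB_swap]
    cases b <;> simp [sgn]

/-- Sorting of two numbers. -/
def sort2 (a b : ℕ) (k : ℕ → ℕ → α) : α := bif a.ble b then k a b else k b a

theorem exists_sort2 (a b : ℕ) : ∃ a' b' : ℕ, (a' = a ∧ b' = b ∨ a' = b ∧ b' = a) ∧
    ∀ {α : Type} (k : ℕ → ℕ → α), sort2 a b k = k a' b' := by
  unfold sort2
  cases a.ble b
  · exact ⟨b, a, .inr ⟨rfl, rfl⟩, fun _ => rfl⟩
  · exact ⟨a, b, .inl ⟨rfl, rfl⟩, fun _ => rfl⟩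

/-- The code of the chord diagram with four given chords. -/
def packSorted (a b c d : ℕ) (k : ℕ → α) : α :=
  sort2 a b fun a b => sort2 c d fun c d => sort2 a c fun a c => sort2 b d fun b d =>
    sort2 b c fun b c => forceNat ((((((a.mul 100).add b).mul 100).add c).mul 100).add d) k

theorem chordProd_decode (n : ℕ) (w : Fin 8 → Fin (2 * g)) : chordProd g (decode n) w =
    chordValue (n / 1000000) w * chordValue (n / 10000) w * chordValue (n / 100) w *
      chordValue n w := by
  simp [chordProd, decode, chordValue, mul_assoc]

theorem chordValue_add (m c : ℕ) (w : Fin 8 → Fin (2 * g)) :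
    chordValue (m * 100 + c) w = chordValue c w := by
  have : decodeChord (m * 100 + c) = decodeChord c :=
    Prod.ext (Fin.ext (by simp only [decodeChord, Fin.val_ofNat]; omega))
      (Fin.ext (by simp only [decodeChord, Fin.val_ofNat]; omega))
  rw [chordValue, this, chordValue]

theorem exists_packSorted {a b c d : ℕ} (ha : a < 100) (hb : b < 100) (hc : c < 100)
    (hd : d < 100) : ∃ n : ℕ,
      (∀ {g : ℕ} (w : Fin 8 → Fin (2 * g)), chordProd g (decode n) w =
        chordValue a w * chordValue b w * chordValue c w * chordValue d w) ∧
      ∀ {α : Type} (k : ℕ → α), packSorted a b c d k = k n := by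
  obtain ⟨a₁, b₁, h₁, hk₁⟩ := exists_sort2 a b
  obtain ⟨c₁, d₁, h₂, hk₂⟩ := exists_sort2 c d
  obtain ⟨a₂, c₂, h₃, hk₃⟩ := exists_sort2 a₁ c₁
  obtain ⟨b₂, d₂, h₄, hk₄⟩ := exists_sort2 b₁ d₁
  obtain ⟨b₃, c₃, h₅, hk₅⟩ := exists_sort2 b₂ c₂
  refine ⟨((a₂ * 100 + b₃) * 100 + c₃) * 100 + d₂, fun w => ?_, fun k => ?_⟩
  · have hb₃ : b₃ < 100 := by omega
    have hc₃ : c₃ < 100 := by omega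
    have hd₂ : d₂ < 100 := by omega
    have e₁ : (((a₂ * 100 + b₃) * 100 + c₃) * 100 + d₂) / 1000000 = a₂ := by omega
    have e₂ : (((a₂ * 100 + b₃) * 100 + c₃) * 100 + d₂) / 10000 = a₂ * 100 + b₃ := by omega
    have e₃ : (((a₂ * 100 + b₃) * 100 + c₃) * 100 + d₂) / 100 =
      (a₂ * 100 + b₃) * 100 + c₃ := by omega
    rw [chordProd_decode, e₁, e₂, e₃, chordValue_add, chordValue_add, chordValue_add]
    have key : ∀ {x y x' y' : ℕ}, (x' = x ∧ y' = y ∨ x' = y ∧ y' = x) →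
        chordValue x' w * chordValue y' w = chordValue x w * chordValue y w := by
      rintro x y x' y' (⟨rfl, rfl⟩ | ⟨rfl, rfl⟩)
      · rfl
      · exact mul_comm ..
    linear_combination chordValue a₂ w * chordValue d₂ w * key h₅ +
      chordValue b₂ w * chordValue d₂ w * key h₃ + chordValue a₁ w * chordValue c₁ w * key h₄ +
      chordValue c₁ w * chordValue d₁ w * key h₁ + chordValue a w * chordValue b w * key h₂
  · rw [packSorted, hk₁, hk₂, hk₃, hk₄, hk₅, forceNat_eq]
    rfl

/-- The image of a chord diagram under a map of endpoints; the boolean tells whether the sign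
changes. -/
def mapDiagram (σ : ℕ → ℕ) (n : ℕ) (k : Bool → ℕ → α) : α :=
  orient σ (n.div 1000000) false fun s a => orient σ (n.div 10000) s fun s b =>
    orient σ (n.div 100) s fun s c => orient σ n s fun s d => packSorted a b c d (k s)

theorem exists_mapDiagram {σ : ℕ → ℕ} {κ : Fin 8 → Fin 8} (hσ : ∀ i : Fin 8, σ i = κ i) (n : ℕ) :
    ∃ (b : Bool) (n' : ℕ),
      (∀ {g : ℕ} (w : Fin 8 → Fin (2 * g)),
        chordProd g (decode n) (w ∘ κ) = sgn b * chordProd g (decode n') w) ∧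
      ∀ {α : Type} (k : Bool → ℕ → α), mapDiagram σ n k = k b n' := by
  obtain ⟨s₁, a, ha, h₁, hk₁⟩ := exists_orient hσ (n.div 1000000) false
  obtain ⟨s₂, b, hb, h₂, hk₂⟩ := exists_orient hσ (n.div 10000) s₁
  obtain ⟨s₃, c, hc, h₃, hk₃⟩ := exists_orient hσ (n.div 100) s₂
  obtain ⟨s₄, d, hd, h₄, hk₄⟩ := exists_orient hσ n s₃
  obtain ⟨n', h, hk⟩ := exists_packSorted ha hb hc hd
  refine ⟨s₄, n', fun w => ?_, fun k => by rw [mapDiagram, hk₁, hk₂, hk₃, hk₄, hk]⟩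
  have h₁ := h₁ w
  rw [sgn, cond_false, one_mul] at h₁
  have h₂ := h₂ w
  have h₃ := h₃ w
  have h₄ := h₄ w
  rw [h, chordProd_decode]
  change chordValue (n.div 1000000) _ * chordValue (n.div 10000) _ * chordValue (n.div 100) _ * _ =
    _
  linear_combination
    chordValue (n.div 10000) (w ∘ κ) * chordValue (n.div 100) (w ∘ κ) * chordValue n (w ∘ κ) * h₁ +
    chordValue a w * chordValue (n.div 100) (w ∘ κ) * chordValue n (w ∘ κ) * h₂ +
    chordValue a w * chordValue b w * chordValue n (w ∘ κ) * h₃ +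
    chordValue a w * chordValue b w * chordValue c w * h₄

/-- The image of a formal sum under a map of endpoints, up to the sign encoded by `ε`. -/
def mapSum (ε : Bool) (σ : ℕ → ℕ) (s : ChordSum) : ChordSum :=
  List.rec [] (fun x _ ih => mapDiagram σ x.2 fun b n =>
    forceInt (bif b.xor ε then x.1.neg else x.1) fun c => (c, n) :: ih) s

theorem ev_mapSum (ε : Bool) {σ : ℕ → ℕ} {κ : Fin 8 → Fin 8} (hσ : ∀ i : Fin 8, σ i = κ i)
    (s : ChordSum) : ev g (mapSum ε σ s) = sgn ε • permL g κ (ev g s) := by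
  induction s with
  | nil => simp [mapSum, ev_nil]
  | cons x s ih =>
    obtain ⟨b, n, hn, hk⟩ := exists_mapDiagram hσ x.2
    change ev g (mapDiagram σ x.2 fun b n =>
      forceInt (bif b.xor ε then x.1.neg else x.1) fun c => (c, n) :: mapSum ε σ s) = _
    rw [hk, forceInt_eq, ev_cons, ih, ev_cons, map_add, smul_add]
    congr 1
    funext w
    have hneg : x.1.neg = -x.1 := rfl
    cases b <;> cases ε <;> simp [permL_apply, hn w, sgn, hneg]

/-- The combination `s + ε • σ(s)`, with like terms collected. -/
def addMapSum (ε : Bool) (σ : ℕ → ℕ) (s : ChordSum) : ChordSum :=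
  forceSum s fun s => mergeSum s (sortSum 7 (mapSum ε σ s))

theorem ev_addMapSum (ε : Bool) {σ : ℕ → ℕ} {κ : Fin 8 → Fin 8} (hσ : ∀ i : Fin 8, σ i = κ i)
    (s : ChordSum) : ev g (addMapSum ε σ s) = ev g s + sgn ε • permL g κ (ev g s) := by
  rw [addMapSum, forceSum_eq, ev_mergeSum, ev_sortSum, ev_mapSum ε hσ]

/-- An integral linear combination of sorted formal sums. -/
def lin : List ℤ → List ChordSum → ChordSum
  | c :: cs, s :: ss => mergeSum (s.map fun x => (c * x.1, x.2)) (lin cs ss)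
  | _, _ => []

theorem ev_lin_cons (c : ℤ) (s : ChordSum) (cs : List ℤ) (ss : List ChordSum) :
    ev g (lin (c :: cs) (s :: ss)) = (c : ℚ) • ev g s + ev g (lin cs ss) := by
  rw [lin, ev_mergeSum]
  congr 1
  induction s with
  | nil => simp [ev_nil]
  | cons x s ih => rw [List.map_cons, ev_cons, ev_cons, ih, smul_add, smul_smul, Int.cast_mul]

theorem ev_lin_mem {S : Submodule ℚ (Tens g 8)} :
    ∀ (cs : List ℤ) {ss : List ChordSum}, (∀ s ∈ ss, ev g s ∈ S) → ev g (lin cs ss) ∈ S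
  | [], _, _ => S.zero_mem
  | _ :: _, [], _ => S.zero_mem
  | c :: cs, s :: ss, h => by
    rw [ev_lin_cons]
    exact S.add_mem (S.smul_mem _ (h s (by simp)))
      (ev_lin_mem cs fun s hs => h s (List.mem_cons_of_mem _ hs))

/-- Whether all the coefficients of a formal sum vanish. -/
def isZero (s : ChordSum) : Bool := s.all fun x => x.1 == 0

theorem ev_of_isZero {s : ChordSum} (h : isZero s = true) : ev g s = 0 := by
  refine (Submodule.mem_bot ℚ).1 ((⊥ : Submodule ℚ (Tens g 8)).list_sum_mem ?_)
  simp only [isZero, List.all_eq_true, beq_iff_eq] at h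
  simp only [List.mem_map]
  rintro _ ⟨x, hx, rfl⟩
  simp [h x hx]

/-- The slot permutations occurring in the Dynkin operator: `f` goes to the last slot. -/
def toLast (f n : ℕ) : ℕ := bif n.blt f then n else bif n.beq f then 7 else n.pred

/-- The operator `liftL (dynkin g 6)` on formal sums. -/
def dynkinSum (s : ChordSum) : ChordSum :=
  [1, 2, 3, 4, 5, 6].foldr (fun f s => addMapSum true (toLast f) s) s

/-- The operator `rotSum` on formal sums. -/
def rotChordSum (s : ChordSum) : ChordSum :=
  [4, 2, 1].foldr (fun k s => addMapSum false (fun i => (i.add k).mod 8) s) s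

theorem ev_addMapSum_toLast {f : ℕ} {κ : Fin 8 → Fin 8} (h : ∀ i : Fin 8, toLast f i = κ i)
    (s : ChordSum) : ev g (addMapSum true (toLast f) s) =
      (LinearMap.id - permL g κ : Tens g 8 →ₗ[ℚ] Tens g 8) (ev g s) := by
  rw [ev_addMapSum _ h, LinearMap.sub_apply, LinearMap.id_apply]
  simp [sub_eq_add_neg, sgn]

theorem ev_dynkinSum (s : ChordSum) : ev g (dynkinSum s) = liftL (dynkin g 6) (ev g s) := by
  simp only [dynkin, betaL_eq, liftL_comp, liftL_id_sub_permL, liftL_id, LinearMap.comp_apply,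
    LinearMap.id_apply, dynkinSum, List.foldr]
  iterate 6 rw [ev_addMapSum_toLast]
  all_goals decide

theorem ev_rotChordSum (s : ChordSum) : ev g (rotChordSum s) = rotSum g (ev g s) := by
  have h : ∀ (k : ℕ) (s : ChordSum), ev g (addMapSum false (fun i => (i.add k).mod 8) s) =
      ev g s + permL g (· + Fin.ofNat 8 k) (ev g s) := fun k s => by
    rw [ev_addMapSum false (κ := (· + Fin.ofNat 8 k)) fun i => ?_, sgn, cond_false, one_smul]
    change (i.val + k) % 8 = _
    simp [Fin.val_add]
  simp only [rotChordSum, List.foldr, h]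
  funext w
  simp [permL_apply, rotSum_apply, Fin.sum_univ_eight, Function.comp_def, add_assoc]
  rfl

end ChordSum

/-! ## The invariants of degree six -/

section Certificates

/-- The code of a chord diagram. -/
def encode (l : List (Fin 8 × Fin 8)) : ℕ :=
  l.foldl (fun n c => 100 * n + (10 * c.1.val + c.2.val)) 0

/-- Representatives of the chord diagrams up to rotation, with the coordinates of their images
under `rotSum ∘ liftL (dynkin g 6) ∘ rotSum` with respect to `generators`. -/
def orbitReps : List (ℕ × List ℤ) := [
  (01234567, [8, 0, 0, 0, 0]),
  (01234657, [-12, 20, 4, -16, 12]),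
  (01234756, [-16, 0, 0, 0, 0]),
  (01243657, [-6, 4, -4, -10, 12]),
  (01243756, [0, 0, 0, 0, 0]),
  (01253647, [0, -16, -16, 0, 12]),
  (01253746, [-2, 0, 2, 2, -6]),
  (01263547, [-2, 0, 2, 2, -6]),
  (01263745, [4, -20, -4, 16, -12]),
  (01273546, [0, 20, 8, -12, 0]),
  (01273645, [0, 16, -8, -24, 32]),
  (02134657, [0, -16, -16, 0, 8]),
  (02143657, [-2, 12, 0, -6, 8]),
  (02153647, [0, 0, 0, 0, 0]),
  (02153746, [0, 0, 0, 0, 0]),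
  (03152647, [0, 4, 4, 4, 12]),
  (03162547, [0, 0, 0, 8, -8])]

/-- Formal sums whose images under `rotSum` span the invariants of degree six. -/
def generators : List ChordSum := [
  [(1, 01234567), (-3, 01234756)],
  [(1, 01234657), (-4, 01243657), (2, 01253647), (-1, 02134657), (6, 02143657),
    (-1, 03152647), (2, 03162547)],
  [(-1, 01234756), (4, 01243657), (-4, 01253647), (1, 01253746), (1, 01263547),
    (-1, 01273546), (-6, 02143657), (3, 03152647), (-3, 03162547)],
  [(1, 01234756), (-4, 01243657), (2, 01253647), (1, 01263745), (-2, 01273546),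
    (-2, 02134657), (6, 02143657), (1, 03152647), (1, 03162547)],
  [(-2, 01273546), (1, 01273645), (-1, 02134657), (2, 03152647), (-1, 03162547)]]

/-- Whether a chord diagram is, up to rotation and sign, trivial or one of the representatives. -/
def isCovered (m : ℕ) : Bool :=
  forceSum (rotChordSum [(1, m)]) fun s => isZero s || match s with
    | [] => false
    | (_, l) :: _ => (orbitReps.any fun r => r.1 == l) &&
      (isZero (rotChordSum (mergeSum [(1, m)] [(1, l)])) ||
        isZero (rotChordSum (mergeSum [(1, m)] [(-1, l)])))

theorem isCovered_matchings :
    ((matchings 4 (List.finRange 8)).all fun m =>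
    decide (decode (encode m) = m) && isCovered (encode m)) = true := by
  decide +kernel

theorem isZero_orbitReps : (orbitReps.all fun r => isZero (rotChordSum
    (mergeSum (dynkinSum (rotChordSum [(1, r.1)])) (lin (r.2.map fun c => -c) generators)))) =
    true := by
  decide +kernel

theorem isZero_generators : (generators.all fun z => isZero
    (mergeSum (dynkinSum (rotChordSum z)) (lin [-7] [rotChordSum z]))) = true := by
  decide +kernel

theorem endpoints_generators : (generators.all fun z => z.all fun x =>
    (endpoints (decode x.2)).isPerm (List.finRange 8)) = true := by
  decide +kernel

/-- A Pfaffian relation, valid for `g = 2`. -/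
def relationTwo : ChordSum :=
  [(1, 07123456), (-1, 07123546), (1, 07123645), (-1, 07132456), (1, 07132546),
    (-1, 07132645), (1, 07142356), (-1, 07142536), (1, 07142635), (-1, 07152346),
    (1, 07152436), (-1, 07152634), (1, 07162345), (-1, 07162435), (1, 07162534)]

theorem isZero_relationTwo : isZero (rotChordSum
    (mergeSum (dynkinSum relationTwo) (lin [2, -4, -4, -2, 8] generators))) = true := by
  decide +kernel

/-- Plücker relations, valid for `g = 1`. -/
def relationsOne : List (ChordSum × List ℤ) := [
  ([(1, 01243567), (-1, 06172435), (1, 07162435)], [-8, 8, 8, 0, 0]),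
  ([(1, 01263547), (-1, 03152647), (1, 05132647)], [0, -12, -4, 4, -4]),
  ([(1, 01234567), (-1, 04152367), (1, 05142367)], [0, 8, 0, -8, 8]),
  ([(1, 01253746), (-1, 04162537), (1, 06142537)], [0, 4, 0, -4, -4])]

theorem isZero_relationsOne : (relationsOne.all fun r => isZero (rotChordSum
    (mergeSum (dynkinSum r.1) (lin (r.2.map fun c => -c) generators)))) = true := by
  decide +kernel

/-- The symplectic form on basis vectors, as an integer. -/
def omegaZ (a b : ℕ) : ℤ :=
  if a % 2 = 0 ∧ b = a + 1 then 1 else if b % 2 = 0 ∧ a = b + 1 then -1 else 0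

/-- The value of a formal sum at a word. -/
def evZ (s : ChordSum) (v : Fin 8 → ℕ) : ℤ :=
  (s.map fun x => x.1 * ((decode x.2).map fun c => omegaZ (v c.1) (v c.2)).prod).sum

/-- The values of the rotation sums of the generators at a word. -/
def generatorValues (v : Fin 8 → ℕ) : List ℤ := generators.map fun z => evZ (rotChordSum z) v

theorem generatorValues_three :
    [![4, 5, 1, 2, 0, 1, 0, 3], ![2, 0, 1, 4, 3, 4, 5, 5], ![4, 0, 5, 4, 5, 1, 0, 1],
      ![0, 4, 5, 1, 0, 2, 3, 1], ![3, 4, 5, 3, 1, 0, 2, 2]].map generatorValues =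
    [[0, 0, 0, -2, 0], [0, 0, -1, -2, 0], [0, 1, 0, -2, 0], [4, 0, 0, 0, -2],
      [-3, 0, -1, 1, 0]] := by
  decide +kernel

theorem generatorValues_two :
    [![2, 0, 1, 0, 3, 1, 2, 3], ![3, 2, 2, 0, 0, 1, 1, 3], ![2, 3, 3, 3, 2, 1, 0, 2],
      ![3, 1, 2, 0, 0, 2, 1, 3]].map generatorValues =
    [[0, 1, 0, -2, 0], [0, -2, 2, 0, 0], [-3, -1, 0, -1, 0], [0, 2, 0, 4, 2]] := by
  decide +kernel

theorem generatorValues_one :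
    generatorValues ![1, 1, 1, 0, 0, 0, 1, 0] = [-3, 3, -6, 3, 0] := by
  decide +kernel

end Certificates

section Invariants
variable {g : ℕ}

theorem ev_single (n : ℕ) : ev g [(1, n)] = chordProd g (decode n) := by
  simp [ev]

/-- The rotation sums of the generators. -/
def invariant (g : ℕ) (i : Fin 5) : Tens g 8 := ev g (rotChordSum (generators.getD i []))

theorem invariant_eq (i : Fin 5) : invariant g i = rotSum g (ev g (generators.getD i [])) :=
  ev_rotChordSum _

theorem getD_mem_generators (i : Fin 5) : generators.getD i [] ∈ generators := by
  rw [List.getD_eq_getElem _ _ i.2]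
  exact List.getElem_mem _

theorem permL_add_mem_spInv (k : Fin 8) {t : Tens g 8} (ht : t ∈ spInv g 8) :
    permL g (· + k) t ∈ spInv g 8 :=
  permL_mem_spInv (Equiv.addRight k).bijective ht

theorem invariant_mem_hSp (i : Fin 5) : invariant g i ∈ hSp g 6 := by
  have hi := getD_mem_generators i
  refine ⟨⟨?_, ?_⟩, ?_⟩
  · have h := ev_of_isZero (g := g) (List.all_eq_true.1 isZero_generators _ hi)
    rw [ev_mergeSum, ev_dynkinSum, ev_lin_cons] at h
    change liftL (dynkin g 6) (invariant g i) + (((-7 : ℤ) : ℚ) • invariant g i + 0) = 0 at h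
    have h' : invariant g i = (1 / 7 : ℚ) • liftL (dynkin g 6) (invariant g i) := by
      push_cast at h
      linear_combination (norm := module) (-1 / 7 : ℚ) • h
    rw [h']
    exact Submodule.smul_mem _ _ (liftL_dynkin_mem_HLsub _)
  · rw [invariant_eq]
    exact betaL_rotSum _
  · rw [invariant_eq, rotSum, LinearMap.sum_apply]
    refine Submodule.sum_mem _ fun k _ => permL_add_mem_spInv k (ev_mem fun x hx => ?_)
    have h := List.all_eq_true.1 (List.all_eq_true.1 endpoints_generators _ hi) x hx
    exact chordProd_mem_spInv _ (List.isPerm_iff.1 h)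

theorem rotSum_ev_lin_mem (cs : List ℤ) :
    rotSum g (ev g (lin cs generators)) ∈ Submodule.span ℚ (Set.range (invariant g)) := by
  refine ev_lin_mem (S := (Submodule.span ℚ (Set.range (invariant g))).comap (rotSum g)) cs
    fun s hs => ?_
  obtain ⟨i, hi, rfl⟩ := List.getElem_of_mem hs
  refine Submodule.subset_span ⟨⟨i, hi⟩, ?_⟩
  rw [invariant_eq, List.getD_eq_getElem _ _ hi]

theorem rotSum_ev_lin (a b c d e : ℤ) : rotSum g (ev g (lin [a, b, c, d, e] generators)) =
    (a : ℚ) • invariant g 0 + (b : ℚ) • invariant g 1 + (c : ℚ) • invariant g 2 +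
      (d : ℚ) • invariant g 3 + (e : ℚ) • invariant g 4 := by
  change rotSum g (ev g (lin [a, b, c, d, e] [generators.getD (0 : Fin 5) [],
    generators.getD (1 : Fin 5) [], generators.getD (2 : Fin 5) [], generators.getD (3 : Fin 5) [],
    generators.getD (4 : Fin 5) []])) = _
  simp only [ev_lin_cons, map_add, map_smul, ← invariant_eq]
  rw [lin, ev_nil, map_zero, add_zero]
  · simp only [add_assoc]
  · simp

theorem rotSum_dynkin_rotSum_orbitRep {r : ℕ × List ℤ} (hr : r ∈ orbitReps) :
    rotSum g (liftL (dynkin g 6) (rotSum g (chordProd g (decode r.1)))) ∈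
      Submodule.span ℚ (Set.range (invariant g)) := by
  have h := ev_of_isZero (g := g) (List.all_eq_true.1 isZero_orbitReps r hr)
  rw [ev_rotChordSum, ev_mergeSum, map_add, ev_dynkinSum, ev_rotChordSum, ev_single] at h
  rw [eq_neg_of_add_eq_zero_left h]
  exact Submodule.neg_mem _ (rotSum_ev_lin_mem _)

theorem rotSum_of_isCovered {n : ℕ} (hn : isCovered n = true) :
    rotSum g (chordProd g (decode n)) = 0 ∨ ∃ r ∈ orbitReps,
      rotSum g (chordProd g (decode n)) = rotSum g (chordProd g (decode r.1)) ∨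
      rotSum g (chordProd g (decode n)) = -rotSum g (chordProd g (decode r.1)) := by
  rw [isCovered, forceSum_eq, Bool.or_eq_true] at hn
  rcases hn with hn | hn
  · left
    rw [← ev_single, ← ev_rotChordSum]
    exact ev_of_isZero hn
  generalize rotChordSum [(1, n)] = s at hn
  match s with
  | [] => exact absurd hn Bool.false_ne_true
  | (_, l) :: _ =>
    rw [Bool.and_eq_true, Bool.or_eq_true, List.any_eq_true] at hn
    obtain ⟨⟨r, hr, hrl⟩, h⟩ := hn
    obtain rfl := eq_of_beq hrl
    refine .inr ⟨r, hr, ?_⟩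
    refine h.symm.imp (fun h => ?_) (fun h => ?_)
    all_goals
      have h := ev_of_isZero (g := g) h
      rw [ev_rotChordSum, ev_mergeSum, map_add, ev_single, ev_cons, ev_nil] at h
      simp at h
      linear_combination h

theorem rotSum_dynkin_rotSum_mem {t : Tens g 8} (ht : t ∈ spInv g 8) :
    rotSum g (liftL (dynkin g 6) (rotSum g t)) ∈ Submodule.span ℚ (Set.range (invariant g)) := by
  suffices h : spInv g 8 ≤ (Submodule.span ℚ (Set.range (invariant g))).comap
      (rotSum g ∘ₗ liftL (dynkin g 6) ∘ₗ rotSum g) from h ht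
  refine (spInv_le_span_chordProd 8).trans (Submodule.span_le.2 ?_)
  rintro _ ⟨l, hl, rfl⟩
  obtain ⟨m, hm, h⟩ := exists_mem_matchings (g := g) 4 (List.finRange 8) (by simp) l hl
  have hm := List.all_eq_true.1 isCovered_matchings m hm
  rw [Bool.and_eq_true, decide_eq_true_eq] at hm
  have hmem : chordProd g m ∈ (Submodule.span ℚ (Set.range (invariant g))).comap
      (rotSum g ∘ₗ liftL (dynkin g 6) ∘ₗ rotSum g) := by
    rw [Submodule.mem_comap, LinearMap.comp_apply, LinearMap.comp_apply]
    rw [← hm.1]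
    rcases rotSum_of_isCovered (g := g) hm.2 with h | ⟨r, hr, h | h⟩ <;> rw [h]
    · simp
    · exact rotSum_dynkin_rotSum_orbitRep hr
    · rw [map_neg, map_neg]
      exact Submodule.neg_mem _ (rotSum_dynkin_rotSum_orbitRep hr)
  rcases h with h | h
  · rw [show chordProd g l = chordProd g m from funext h]
    exact hmem
  · rw [show chordProd g l = -chordProd g m from funext h]
    exact Submodule.neg_mem _ hmem

theorem hSp_six_eq_span (g : ℕ) : hSp g 6 = Submodule.span ℚ (Set.range (invariant g)) := by
  refine le_antisymm (fun t ht => ?_) (Submodule.span_le.2 ?_)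
  · have h := rotSum_dynkin_rotSum_mem ht.2
    rw [rotSum_eq_of_betaL ht.1.2, map_smul, liftL_dynkin_of_mem_HLsub ht.1.1, map_smul, map_smul,
      rotSum_eq_of_betaL ht.1.2, smul_smul, smul_smul] at h
    exact (Submodule.smul_mem_iff _ (by norm_num)).1 h
  · rintro _ ⟨i, rfl⟩
    exact invariant_mem_hSp i

theorem omegaB_eq_omegaZ (a b : Fin (2 * g)) : omegaB g a b = omegaZ a b := by
  obtain ⟨i, rfl | rfl⟩ := exists_xI_or_yI a <;> obtain ⟨j, rfl | rfl⟩ := exists_xI_or_yI b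
  · rw [omegaB_xI_xI, omegaZ, if_neg, if_neg, Int.cast_zero] <;> simp only [xI] <;> omega
  · have : (i = j) ↔ 2 * j.val + 1 = 2 * i.val + 1 := by rw [Fin.ext_iff]; omega
    rw [omegaB_xI_yI, omegaZ]
    simp only [xI, yI, Nat.mul_mod_right, true_and, this]
    split_ifs <;> first | omega | simp
  · have : (i = j) ↔ 2 * i.val + 1 = 2 * j.val + 1 := by rw [Fin.ext_iff]; omega
    rw [omegaB_yI_xI, omegaZ]
    simp only [xI, yI, Nat.mul_mod_right, true_and, this]
    split_ifs <;> first | omega | simp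
  · rw [omegaB_yI_yI, omegaZ, if_neg, if_neg, Int.cast_zero] <;> simp only [yI] <;> omega

theorem ev_eq_evZ (s : ChordSum) (w : Fin 8 → Fin (2 * g)) :
    ev g s w = evZ s (fun i => w i) := by
  induction s with
  | nil => simp [ev_nil, evZ]
  | cons x s ih =>
    rw [ev_cons, Pi.add_apply, ih]
    simp [evZ, chordProd, decode, omegaB_eq_omegaZ]

theorem sum_smul_invariant_apply {v : Fin 8 → ℕ} (hv : ∀ i, v i < 2 * g) {a b c d e : ℤ}
    (h : generatorValues v = [a, b, c, d, e]) (x : Fin 5 → ℚ) :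
    (∑ i, x i • invariant g i) (fun i => ⟨v i, hv i⟩) =
      x 0 * a + x 1 * b + x 2 * c + x 3 * d + x 4 * e := by
  have h' : ∀ i, invariant g i (fun i => ⟨v i, hv i⟩) = ![(a : ℚ), b, c, d, e] i := fun i => by
    rw [invariant, ev_eq_evZ]
    change [evZ (rotChordSum (generators.getD (0 : Fin 5) [])) v,
      evZ (rotChordSum (generators.getD (1 : Fin 5) [])) v,
      evZ (rotChordSum (generators.getD (2 : Fin 5) [])) v,
      evZ (rotChordSum (generators.getD (3 : Fin 5) [])) v,
      evZ (rotChordSum (generators.getD (4 : Fin 5) [])) v] = _ at h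
    simp only [List.cons.injEq, and_true] at h
    obtain ⟨h₀, h₁, h₂, h₃, h₄⟩ := h
    fin_cases i
    exacts [congrArg _ h₀, congrArg _ h₁, congrArg _ h₂, congrArg _ h₃, congrArg _ h₄]
  simp only [Finset.sum_apply, Pi.smul_apply, smul_eq_mul, h', Fin.sum_univ_five]
  rfl

theorem linearIndependent_invariant (hg : 3 ≤ g) : LinearIndependent ℚ (invariant g) := by
  rw [Fintype.linearIndependent_iff]
  intro x hx
  have h := generatorValues_three
  simp only [List.map_cons, List.map_nil, List.cons.injEq, and_true] at h
  obtain ⟨h₀, h₁, h₂, h₃, h₄⟩ := h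
  have hlt : ∀ {v : Fin 8 → ℕ}, (∀ i, v i < 6) → ∀ i, v i < 2 * g := fun h i =>
    (h i).trans_le (by omega)
  have e₀ := sum_smul_invariant_apply (hlt (by decide)) h₀ x
  have e₁ := sum_smul_invariant_apply (hlt (by decide)) h₁ x
  have e₂ := sum_smul_invariant_apply (hlt (by decide)) h₂ x
  have e₃ := sum_smul_invariant_apply (hlt (by decide)) h₃ x
  have e₄ := sum_smul_invariant_apply (hlt (by decide)) h₄ x
  simp only [hx, Pi.zero_apply] at e₀ e₁ e₂ e₃ e₄
  push_cast at e₀ e₁ e₂ e₃ e₄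
  intro i
  fin_cases i <;> simp only [Fin.zero_eta, Fin.mk_one, Fin.reduceFinMk] <;> linarith

theorem pfaffian_six_eq_zero (p q r s : Fin 8 → ℚ) (u : Fin 8 → Fin 8 → ℚ)
    (hu : ∀ i j, u i j = p i * q j - q i * p j + (r i * s j - s i * r j)) :
    u 1 2 * u 3 4 * u 5 6 - u 1 2 * u 3 5 * u 4 6 + u 1 2 * u 3 6 * u 4 5 -
      u 1 3 * u 2 4 * u 5 6 + u 1 3 * u 2 5 * u 4 6 - u 1 3 * u 2 6 * u 4 5 +
      u 1 4 * u 2 3 * u 5 6 - u 1 4 * u 2 5 * u 3 6 + u 1 4 * u 2 6 * u 3 5 -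
      u 1 5 * u 2 3 * u 4 6 + u 1 5 * u 2 4 * u 3 6 - u 1 5 * u 2 6 * u 3 4 +
      u 1 6 * u 2 3 * u 4 5 - u 1 6 * u 2 4 * u 3 5 + u 1 6 * u 2 5 * u 3 4 = 0 := by
  simp only [hu]
  ring

theorem ev_relationTwo : ev 2 relationTwo = 0 := by
  funext w
  have h := pfaffian_six_eq_zero (fun i => stdB 2 (w i) (xI 0)) (fun i => stdB 2 (w i) (yI 0))
    (fun i => stdB 2 (w i) (xI 1)) (fun i => stdB 2 (w i) (yI 1))
    (fun i j => omegaB 2 (w i) (w j)) fun i j => by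
      simp only [omegaB, omegaF, Fin.sum_univ_two]
  simp only [relationTwo, ev_cons, ev_nil, Pi.add_apply, Pi.smul_apply, chordProd, decode,
    decodeChord, smul_eq_mul, List.map_cons, List.map_nil, List.prod_cons, List.prod_nil]
  simp only [Nat.reduceDiv]
  push_cast
  rw [Pi.zero_apply]
  linear_combination omegaB 2 (w 0) (w 7) * h

theorem invariant_two_zero : invariant 2 0 = (2 : ℚ) • invariant 2 1 + (2 : ℚ) • invariant 2 2 +
    invariant 2 3 - (4 : ℚ) • invariant 2 4 := by
  have h := ev_of_isZero (g := 2) isZero_relationTwo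
  rw [ev_rotChordSum, ev_mergeSum, ev_dynkinSum, ev_relationTwo, map_zero, zero_add,
    rotSum_ev_lin] at h
  push_cast at h
  linear_combination (norm := module) (1 / 2 : ℚ) • h

theorem linearIndependent_invariant_two :
    LinearIndependent ℚ fun i : Fin 4 => invariant 2 i.succ := by
  rw [Fintype.linearIndependent_iff]
  intro x hx
  have hx : ∑ i, (Fin.cons 0 x : Fin 5 → ℚ) i • invariant 2 i = 0 := by
    rw [Fin.sum_univ_succ, Fin.cons_zero, zero_smul, zero_add]
    exact hx
  have h := generatorValues_two
  simp only [List.map_cons, List.map_nil, List.cons.injEq, and_true] at h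
  obtain ⟨h₀, h₁, h₂, h₃⟩ := h
  have e₀ := sum_smul_invariant_apply (g := 2) (by decide) h₀ (Fin.cons 0 x)
  have e₁ := sum_smul_invariant_apply (g := 2) (by decide) h₁ (Fin.cons 0 x)
  have e₂ := sum_smul_invariant_apply (g := 2) (by decide) h₂ (Fin.cons 0 x)
  have e₃ := sum_smul_invariant_apply (g := 2) (by decide) h₃ (Fin.cons 0 x)
  simp only [hx, Pi.zero_apply] at e₀ e₁ e₂ e₃
  change 0 = 0 * _ + x 0 * _ + x 1 * _ + x 2 * _ + x 3 * _ at e₀ e₁ e₂ e₃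
  push_cast at e₀ e₁ e₂ e₃
  intro i
  fin_cases i <;> simp only [Fin.zero_eta, Fin.mk_one, Fin.reduceFinMk] <;> linarith

theorem omegaB_one (a b : Fin (2 * 1)) :
    omegaB 1 a b = stdB 1 a (xI 0) * stdB 1 b (yI 0) - stdB 1 a (yI 0) * stdB 1 b (xI 0) := by
  simp [omegaB, omegaF]

theorem ev_relationsOne {r : ChordSum × List ℤ} (hr : r ∈ relationsOne) : ev 1 r.1 = 0 := by
  funext w
  rw [Pi.zero_apply]
  simp only [relationsOne, List.mem_cons, List.not_mem_nil, or_false] at hr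
  rcases hr with rfl | rfl | rfl | rfl
  all_goals
    simp only [ev_cons, ev_nil, Pi.add_apply, Pi.smul_apply, chordProd, decode, decodeChord,
      smul_eq_mul, List.map_cons, List.map_nil, List.prod_cons, List.prod_nil, Nat.reduceDiv,
      omegaB_one]
    push_cast
    rw [Pi.zero_apply]
    ring

theorem rotSum_ev_lin_relationsOne {r : ChordSum × List ℤ} (hr : r ∈ relationsOne) :
    rotSum 1 (ev 1 (lin (r.2.map fun c => -c) generators)) = 0 := by
  have h := ev_of_isZero (g := 1) (List.all_eq_true.1 isZero_relationsOne r hr)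
  rwa [ev_rotChordSum, ev_mergeSum, ev_dynkinSum, ev_relationsOne hr, map_zero, zero_add] at h

theorem invariant_one : invariant 1 0 = -invariant 1 3 ∧ invariant 1 1 = invariant 1 3 ∧
    invariant 1 2 = (-2 : ℚ) • invariant 1 3 ∧ invariant 1 4 = 0 := by
  have h : ∀ r ∈ relationsOne, _ := fun r hr => rotSum_ev_lin_relationsOne hr
  simp only [relationsOne, List.forall_mem_cons, List.map_cons, List.map_nil, rotSum_ev_lin] at h
  obtain ⟨h₀, h₁, h₂, h₃, -⟩ := h
  push_cast at h₀ h₁ h₂ h₃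
  refine ⟨?_, ?_, ?_, ?_⟩
  · linear_combination (norm := module)
      (1 / 8 : ℚ) • h₀ + (1 / 4 : ℚ) • h₁ + (3 / 16 : ℚ) • h₂ + (1 / 8 : ℚ) • h₃
  · linear_combination (norm := module) (-1 / 16 : ℚ) • h₂ + (-1 / 8 : ℚ) • h₃
  · linear_combination (norm := module) (1 / 4 : ℚ) • h₁ + (1 / 4 : ℚ) • h₂ + (1 / 4 : ℚ) • h₃
  · linear_combination (norm := module) (-1 / 16 : ℚ) • h₂ + (1 / 8 : ℚ) • h₃

theorem invariant_one_three_ne_zero : invariant 1 3 ≠ 0 := fun h => by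
  have e := sum_smul_invariant_apply (g := 1) (by decide) generatorValues_one (Pi.single 3 1)
  simp [Pi.single_apply, Fin.sum_univ_five, h] at e

theorem span_invariant_one :
    Submodule.span ℚ (Set.range (invariant 1)) = Submodule.span ℚ {invariant 1 3} := by
  obtain ⟨h₀, h₁, h₂, h₄⟩ := invariant_one
  refine le_antisymm (Submodule.span_le.2 ?_) (Submodule.span_mono (by simp))
  have h := Submodule.mem_span_singleton_self (R := ℚ) (invariant 1 3)
  rintro _ ⟨i, rfl⟩
  rw [SetLike.mem_coe]
  match i with
  | 0 => rw [h₀]; exact Submodule.neg_mem _ h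
  | 1 => rw [h₁]; exact h
  | 2 => rw [h₂]; exact Submodule.smul_mem _ _ h
  | 3 => exact h
  | 4 => rw [h₄]; exact Submodule.zero_mem _

theorem span_invariant_two : Submodule.span ℚ (Set.range (invariant 2)) =
    Submodule.span ℚ (Set.range fun i : Fin 4 => invariant 2 i.succ) := by
  have h (i : Fin 4) : invariant 2 i.succ ∈
      Submodule.span ℚ (Set.range fun i : Fin 4 => invariant 2 i.succ) :=
    Submodule.subset_span ⟨i, rfl⟩
  refine le_antisymm (Submodule.span_le.2 ?_) (Submodule.span_mono ?_)
  · rintro _ ⟨i, rfl⟩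
    refine Fin.cases ?_ h i
    rw [invariant_two_zero]
    exact Submodule.sub_mem _ (Submodule.add_mem _ (Submodule.add_mem _
      (Submodule.smul_mem _ _ (h 0)) (Submodule.smul_mem _ _ (h 1))) (h 2))
      (Submodule.smul_mem _ _ (h 3))
  · rintro _ ⟨i, rfl⟩
    exact ⟨i.succ, rfl⟩

end Invariants

/-- **Statement 19** (Table 4): `dim h_{1,1}(6)^{Sp} = 1`, `dim h_{2,1}(6)^{Sp} = 4`,
and `dim h_{g,1}(6)^{Sp} = 5` for all `g ≥ 3`. -/
theorem dim_hSp_six :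
    Module.finrank ℚ ↥(hSp 1 6) = 1 ∧
    Module.finrank ℚ ↥(hSp 2 6) = 4 ∧
    (∀ g : ℕ, 3 ≤ g → Module.finrank ℚ ↥(hSp g 6) = 5) := by
  refine ⟨?_, ?_, fun g hg => ?_⟩ <;> rw [hSp_six_eq_span]
  · rw [span_invariant_one]
    exact finrank_span_singleton invariant_one_three_ne_zero
  · rw [span_invariant_two, finrank_span_eq_card linearIndependent_invariant_two,
      Fintype.card_fin]
  · rw [finrank_span_eq_card (linearIndependent_invariant hg), Fintype.card_fin]
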